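/- arXiv:2104.10080 — 2 statements merged into one kernel-verified Lean document; each statement's English description precedes it below -/
import Mathlib

section
/- A finite simple graph H satisfies I(H,x) = I(C_9,x) if and only if H is isomorphic to one of the following six graphs: C_9; D_9; the disjoint union of C_3 with A_{1,2}; the disjoint union of C_3 with E_{1,2}; the disjoint union of C_3 with E_{2,1}; the disjoint union of C_3 with B_{0,1,1}. -/
open Polynomial SimpleGraph

/-- A finset of vertices is independent if no two of its vertices are adjacent. -/
def SimpleGraph.IsIndepFinset {V : Type*} (G : SimpleGraph V) (s : Finset V) : Prop :=
  ∀ v ∈ s, ∀ w ∈ s, ¬ G.Adj v w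

open scoped Classical in
/-- The independence polynomial `I(G,x) = Σ_k i_k(G) xᵏ` of a finite simple graph,
regarded as a polynomial with rational coefficients. -/
noncomputable def SimpleGraph.indepPoly {V : Type*} [Fintype V] (G : SimpleGraph V) :
    Polynomial ℚ :=
  ∑ s : Finset V, if G.IsIndepFinset s then (X : Polynomial ℚ) ^ s.card else 0

/-- `Dgraph n` : the graph on `n` vertices consisting of a triangle (on `0,1,2`)
together with a path on `n-3` vertices (`3, …, n-1`) whose endpoint is joined to
the triangle vertex `2`. -/
def Dgraph (n : ℕ) : SimpleGraph (Fin n) :=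
  SimpleGraph.fromRel (fun i j => i.val + 1 = j.val ∨ (i.val = 0 ∧ j.val = 2))

/-- `Agraph m1 m2` : a triangle (on `m1`, `m1+1` and the apex `m1+m2+2`) with
vertex-disjoint pendant paths on `m1` vertices (`0,…,m1-1`) and on `m2` vertices
(`m1+2,…,m1+m2+1`) attached to the two triangle vertices `m1` and `m1+1`. -/
def Agraph (m1 m2 : ℕ) : SimpleGraph (Fin (m1 + m2 + 3)) :=
  SimpleGraph.fromRel (fun i j =>
    (i.val + 1 = j.val ∧ j.val ≤ m1 + m2 + 1) ∨
    (i.val = m1 ∧ j.val = m1 + m2 + 2) ∨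
    (i.val = m1 + 1 ∧ j.val = m1 + m2 + 2))

/-- `Egraph m1 m2` : the cycle `C_{m1+3}` (on `0,…,m1+2`) with a pendant path on
`m2` vertices (`m1+3,…,m1+m2+2`) attached to the cycle vertex `0`. -/
def Egraph (m1 m2 : ℕ) : SimpleGraph (Fin (m1 + m2 + 3)) :=
  SimpleGraph.fromRel (fun i j =>
    (i.val + 1 = j.val ∧ j.val ≤ m1 + 2) ∨
    (i.val = 0 ∧ j.val = m1 + 2) ∨
    (i.val + 1 = j.val ∧ m1 + 3 ≤ i.val) ∨
    (i.val = 0 ∧ j.val = m1 + 3))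

/-- `Bgraph m1 m2 m3` : a triangle `0,1,2`, a path `3,…,m1+2` ending in the vertex
`v = m1+3`, with `3` joined to the triangle vertex `2` (if `m1 = 0` then `v` is joined
directly to `2`), and two vertex-disjoint pendant paths on `m2` vertices
(`m1+4,…,m1+m2+3`) and on `m3` vertices (`m1+m2+4,…,m1+m2+m3+3`) attached to `v`. -/
def Bgraph (m1 m2 m3 : ℕ) : SimpleGraph (Fin (m1 + m2 + m3 + 4)) :=
  SimpleGraph.fromRel (fun i j =>
    (i.val + 1 = j.val ∧ j.val ≤ m1 + 3) ∨
    (i.val = 0 ∧ j.val = 2) ∨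
    (i.val + 1 = j.val ∧ m1 + 4 ≤ i.val ∧ j.val ≤ m1 + m2 + 3) ∨
    (i.val = m1 + 3 ∧ j.val = m1 + 4) ∨
    (i.val + 1 = j.val ∧ m1 + m2 + 4 ≤ i.val) ∨
    (i.val = m1 + 3 ∧ j.val = m1 + m2 + 4))

namespace IC9
def tC : ℕ := nat_lit 612139640463240511097602
def tCh : List (ℕ × List Bool) :=
  [(nat_lit 2, []),
   (nat_lit 2, [true]),
   (nat_lit 2, [true, false]),
   (nat_lit 2, [true, false, false]),
   (nat_lit 2, [true, false, false, false]),
   (nat_lit 2, [true, false, false, false, false]),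
   (nat_lit 2, [true, false, false, false, false, false]),
   (nat_lit 2, [true, false, false, false, false, false, false]),
   (nat_lit 2, [true, false, false, false, false, false, false, true])]

def tD : ℕ := nat_lit 909653340570046586948098
def tDh : List (ℕ × List Bool) :=
  [(nat_lit 1, []),
   (nat_lit 2, [true]),
   (nat_lit 2, [true, false]),
   (nat_lit 2, [true, false, false]),
   (nat_lit 2, [true, false, false, false]),
   (nat_lit 2, [true, false, false, false, false]),
   (nat_lit 3, [true, false, false, false, false, false]),
   (nat_lit 2, [true, false, false, false, false, false, false]),
   (nat_lit 2, [true, true, false, false, false, false, false, false])]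

def tA : ℕ := nat_lit 909652761574099646941698
def tAh : List (ℕ × List Bool) :=
  [(nat_lit 1, []),
   (nat_lit 2, [true]),
   (nat_lit 3, [true, false]),
   (nat_lit 3, [true, false, false]),
   (nat_lit 2, [true, true, false, false]),
   (nat_lit 1, [false, true, false, false, false]),
   (nat_lit 2, [false, false, false, false, false, false]),
   (nat_lit 2, [true, false, false, false, false, false, false]),
   (nat_lit 2, [true, true, false, false, false, false, false, false])]

def tE12 : ℕ := nat_lit 909652761998231966583298
def tE12h : List (ℕ × List Bool) :=
  [(nat_lit 1, []),
   (nat_lit 2, [true]),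
   (nat_lit 3, [true, false]),
   (nat_lit 2, [true, false, false]),
   (nat_lit 2, [true, false, false, false]),
   (nat_lit 2, [true, false, true, false, false]),
   (nat_lit 2, [false, false, false, false, false, false]),
   (nat_lit 2, [true, false, false, false, false, false, false]),
   (nat_lit 2, [true, true, false, false, false, false, false, false])]

def tE21 : ℕ := nat_lit 909652761927863214033410
def tE21h : List (ℕ × List Bool) :=
  [(nat_lit 1, []),
   (nat_lit 3, [true]),
   (nat_lit 2, [true, false]),
   (nat_lit 2, [true, false, false]),
   (nat_lit 2, [true, false, false, false]),
   (nat_lit 2, [true, false, false, true, false]),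
   (nat_lit 2, [false, false, false, false, false, false]),
   (nat_lit 2, [true, false, false, false, false, false, false]),
   (nat_lit 2, [true, true, false, false, false, false, false, false])]

def tB : ℕ := nat_lit 909652762138973470988802
def tBh : List (ℕ × List Bool) :=
  [(nat_lit 1, []),
   (nat_lit 3, [true]),
   (nat_lit 1, [true, false]),
   (nat_lit 3, [false, true, false]),
   (nat_lit 2, [true, false, false, false]),
   (nat_lit 2, [true, true, false, false, false]),
   (nat_lit 2, [false, false, false, false, false, false]),
   (nat_lit 2, [true, false, false, false, false, false, false]),
   (nat_lit 2, [true, true, false, false, false, false, false, false])]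

noncomputable def ext (M w : ℕ) (A B : List ℕ) : List ℕ :=
  List.rec (motive := fun _ => List ℕ → List ℕ) (fun acc => acc)
    (fun s _ ih acc => Bool.rec (ih acc) (ih (Nat.add s w :: acc)) (Nat.beq (Nat.land s M) (nat_lit 0))) A B

noncomputable def noDisj (M : ℕ) (A : List ℕ) : Bool :=
  List.rec true (fun s _ ih => Bool.rec ih false (Nat.beq (Nat.land s M) (nat_lit 0))) A

/-- `lenLe l n` : the length is at most `n` -/
noncomputable def len (l : List ℕ) : ℕ → ℕ :=
  List.rec (fun n => n) (fun _ _ ih n => ih (Nat.succ n)) l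

noncomputable def lenLe (l : List ℕ) : ℕ → Bool :=
  List.rec (fun _ => true) (fun _ _ ih n => Nat.rec false (fun m _ => ih m) n) l

noncomputable def force (l : List ℕ) (k : List ℕ → Bool) : Bool :=
  List.rec (k []) (fun a t _ => k (a :: t)) l

noncomputable def allB {α : Type} (p : α → Bool) (l : List α) : Bool :=
  List.rec true (fun a _ ih => Bool.rec false ih (p a)) l

noncomputable def ifB (b : Bool) (x : Bool) : Bool := Bool.rec true x b

noncomputable def bt (A k : ℕ) : Bool := Nat.beq (Nat.land (nat_lit 1) (Nat.shiftRight A k)) (nat_lit 1)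

noncomputable def pc9 (M : ℕ) : ℕ :=
  Nat.add (Nat.mod M 2) (Nat.add (Nat.mod (Nat.div M 2) 2) (Nat.add (Nat.mod (Nat.div M 4) 2)
  (Nat.add (Nat.mod (Nat.div M 8) 2) (Nat.add (Nat.mod (Nat.div M 16) 2)
  (Nat.add (Nat.mod (Nat.div M 32) 2) (Nat.add (Nat.mod (Nat.div M 64) 2)
  (Nat.add (Nat.mod (Nat.div M 128) 2) (Nat.mod (Nat.div M 256) 2))))))))

noncomputable def forceN {α : Type} (n : ℕ) (k : ℕ → α) : α :=
  Nat.rec (k (nat_lit 0)) (fun m _ => k (Nat.succ m)) n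

noncomputable def img (t : List Bool) : List ℕ → ℕ :=
  List.rec (fun _ => nat_lit 0)
    (fun b _ ih p => List.rec (nat_lit 0)
      (fun x q _ => Bool.rec (ih q) (Nat.add (Nat.pow (nat_lit 2) x) (ih q)) b) p) t

/-- rows: (vertex, neighbours, degree) -/
noncomputable def tryAll (f : ℕ × ℕ × ℕ → Option (List ℕ)) (l : List (ℕ × ℕ × ℕ)) : Option (List ℕ) :=
  List.rec none (fun x _ ih => Option.rec ih (fun q => some q) (f x)) l

noncomputable def place (rows : List (ℕ × ℕ × ℕ)) (ts : List (ℕ × List Bool)) :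
    List ℕ → ℕ → Option (List ℕ) :=
  List.rec (fun p _ => some p.reverse)
    (fun t _ ih p used => Prod.rec (fun d t => forceN (img t p) (fun im =>
      tryAll (fun r => Prod.rec (fun x r => Prod.rec (fun N e =>
        Bool.rec none (Bool.rec none (Bool.rec (ih (x :: p) (Nat.add used (Nat.pow (nat_lit 2) x))) none
          (bt used x)) (Nat.beq (Nat.land N used) im)) (Nat.beq e d)) r) r) rows)) t) ts

noncomputable def mkRows (A : ℕ) (vs : List ℕ) : (List (ℕ × ℕ × ℕ) → Bool) → Bool :=
  List.rec (fun k => k [])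
    (fun x _ ih k => forceN (Nat.mod (Nat.shiftRight A (Nat.mul (nat_lit 9) x)) (nat_lit 512))
      (fun N => forceN (pc9 N) (fun d => ih (fun l => k ((x, N, d) :: l))))) vs

noncomputable def nth (l : List ℕ) : ℕ → ℕ :=
  List.rec (fun _ => nat_lit 0) (fun a _ ih n => Nat.rec a (fun m _ => ih m) n) l

noncomputable def allLt (p : ℕ → Bool) (n : ℕ) : Bool :=
  Nat.rec true (fun m ih => Bool.rec false ih (p m)) n

noncomputable def andB (a b : Bool) : Bool := Bool.rec false b a

noncomputable def chkIso (A T : ℕ) (p : List ℕ) : Bool :=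
  allLt (fun i => forceN (nth p i) (fun x => andB (Nat.ble x (nat_lit 8)) (allLt (fun j =>
    forceN (nth p j) (fun y => andB (Bool.rec true false (Nat.beq x y))
      (Bool.rec (Bool.rec true false (bt T (Nat.add (Nat.mul (nat_lit 9) i) j)))
        (bt T (Nat.add (Nat.mul (nat_lit 9) i) j))
        (bt A (Nat.add (Nat.mul (nat_lit 9) x) y))))) i))) (nat_lit 9)

noncomputable def isoOK (rows : List (ℕ × ℕ × ℕ)) (A T : ℕ) (Th : List (ℕ × List Bool)) : Bool :=
  Option.rec false (fun p => chkIso A T p) (place rows Th [] (nat_lit 0))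

noncomputable def orB (a b : Bool) : Bool := Bool.rec b true a

noncomputable def leafOK (A : ℕ) : Bool :=
  mkRows A [nat_lit 0, nat_lit 1, nat_lit 2, nat_lit 3, nat_lit 4, nat_lit 5, nat_lit 6, nat_lit 7, nat_lit 8]
    (fun rows => orB (isoOK rows A tD tDh) (orB (isoOK rows A tA tAh) (orB (isoOK rows A tE12 tE12h)
      (orB (isoOK rows A tE21 tE21h) (orB (isoOK rows A tB tBh) (isoOK rows A tC tCh))))))

def tb4 : List (ℕ × List (ℕ × ℕ × ℕ)) :=
  [(nat_lit 1, [(nat_lit 1, nat_lit 1, nat_lit 68719476752), (nat_lit 2, nat_lit 2, nat_lit 137438961664), (nat_lit 4, nat_lit 4, nat_lit 274882101248), (nat_lit 8, nat_lit 8, nat_lit 551903297536)]),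
   (nat_lit 2, [(nat_lit 3, nat_lit 3, nat_lit 206158438416), (nat_lit 5, nat_lit 5, nat_lit 343601578000), (nat_lit 6, nat_lit 6, nat_lit 412321062912), (nat_lit 9, nat_lit 9, nat_lit 620622774288), (nat_lit 10, nat_lit 10, nat_lit 689342259200), (nat_lit 12, nat_lit 12, nat_lit 826785398784)]),
   (nat_lit 3, [(nat_lit 7, nat_lit 7, nat_lit 481040539664), (nat_lit 11, nat_lit 11, nat_lit 758061735952), (nat_lit 13, nat_lit 13, nat_lit 895504875536), (nat_lit 14, nat_lit 14, nat_lit 964224360448)]),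
   (nat_lit 4, [(nat_lit 15, nat_lit 15, nat_lit 1032943837200)]),
   (nat_lit 5, [])]

def tb5 : List (ℕ × List (ℕ × ℕ × ℕ)) :=
  [(nat_lit 1, [(nat_lit 1, nat_lit 1, nat_lit 35184372088864), (nat_lit 2, nat_lit 2, nat_lit 70368744194048), (nat_lit 4, nat_lit 4, nat_lit 140737496743936), (nat_lit 8, nat_lit 8, nat_lit 281479271677952)]),
   (nat_lit 2, [(nat_lit 3, nat_lit 3, nat_lit 105553116282912), (nat_lit 5, nat_lit 5, nat_lit 175921868832800), (nat_lit 6, nat_lit 6, nat_lit 211106240937984), (nat_lit 9, nat_lit 9, nat_lit 316663643766816), (nat_lit 10, nat_lit 10, nat_lit 351848015872000), (nat_lit 12, nat_lit 12, nat_lit 422216768421888), (nat_lit 17, nat_lit 1, nat_lit 600333348765728), (nat_lit 18, nat_lit 2, nat_lit 635517720870912), (nat_lit 20, nat_lit 4, nat_lit 705886473420800), (nat_lit 24, nat_lit 8, nat_lit 846628248354816)]),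
   (nat_lit 3, [(nat_lit 7, nat_lit 7, nat_lit 246290613026848), (nat_lit 11, nat_lit 11, nat_lit 387032387960864), (nat_lit 13, nat_lit 13, nat_lit 457401140510752), (nat_lit 14, nat_lit 14, nat_lit 492585512615936), (nat_lit 19, nat_lit 3, nat_lit 670702092959776), (nat_lit 21, nat_lit 5, nat_lit 741070845509664), (nat_lit 22, nat_lit 6, nat_lit 776255217614848), (nat_lit 25, nat_lit 9, nat_lit 881812620443680), (nat_lit 26, nat_lit 10, nat_lit 916996992548864), (nat_lit 28, nat_lit 12, nat_lit 987365745098752)]),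
   (nat_lit 4, [(nat_lit 15, nat_lit 15, nat_lit 527769884704800), (nat_lit 23, nat_lit 7, nat_lit 811439589703712), (nat_lit 27, nat_lit 11, nat_lit 952181364637728), (nat_lit 29, nat_lit 13, nat_lit 1022550117187616), (nat_lit 30, nat_lit 14, nat_lit 1057734489292800)]),
   (nat_lit 5, [(nat_lit 31, nat_lit 15, nat_lit 1092918861381664)])]

def tb6 : List (ℕ × List (ℕ × ℕ × ℕ)) :=
  [(nat_lit 1, [(nat_lit 1, nat_lit 1, nat_lit 18014398509482048), (nat_lit 2, nat_lit 2, nat_lit 36028797018996736), (nat_lit 4, nat_lit 4, nat_lit 72057594054705152), (nat_lit 8, nat_lit 8, nat_lit 144115196665790464)]),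
   (nat_lit 2, [(nat_lit 3, nat_lit 3, nat_lit 54043195528478784), (nat_lit 5, nat_lit 5, nat_lit 90071992564187200), (nat_lit 6, nat_lit 6, nat_lit 108086391073701888), (nat_lit 9, nat_lit 9, nat_lit 162129595175272512), (nat_lit 10, nat_lit 10, nat_lit 180143993684787200), (nat_lit 12, nat_lit 12, nat_lit 216172790720495616), (nat_lit 17, nat_lit 1, nat_lit 306249172707704896), (nat_lit 18, nat_lit 2, nat_lit 324263571217219584), (nat_lit 20, nat_lit 4, nat_lit 360292368252928000), (nat_lit 24, nat_lit 8, nat_lit 432349970864013312), (nat_lit 33, nat_lit 1, nat_lit 596726950626590784), (nat_lit 34, nat_lit 2, nat_lit 614741349136105472), (nat_lit 36, nat_lit 4, nat_lit 650770146171813888), (nat_lit 40, nat_lit 8, nat_lit 722827748782899200)]),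
   (nat_lit 3, [(nat_lit 7, nat_lit 7, nat_lit 126100789583183936), (nat_lit 11, nat_lit 11, nat_lit 198158392194269248), (nat_lit 13, nat_lit 13, nat_lit 234187189229977664), (nat_lit 14, nat_lit 14, nat_lit 252201587739492352), (nat_lit 19, nat_lit 3, nat_lit 342277969726701632), (nat_lit 21, nat_lit 5, nat_lit 378306766762410048), (nat_lit 22, nat_lit 6, nat_lit 396321165271924736), (nat_lit 25, nat_lit 9, nat_lit 450364369373495360), (nat_lit 26, nat_lit 10, nat_lit 468378767883010048), (nat_lit 28, nat_lit 12, nat_lit 504407564918718464), (nat_lit 35, nat_lit 3, nat_lit 632755747645587520), (nat_lit 37, nat_lit 5, nat_lit 668784544681295936), (nat_lit 38, nat_lit 6, nat_lit 686798943190810624), (nat_lit 41, nat_lit 9, nat_lit 740842147292381248), (nat_lit 42, nat_lit 10, nat_lit 758856545801895936), (nat_lit 44, nat_lit 12, nat_lit 794885342837604352), (nat_lit 49, nat_lit 1, nat_lit 884961724824813632), (nat_lit 50, nat_lit 2, nat_lit 902976123334328320), (nat_lit 52, nat_lit 4, nat_lit 939004920370036736), (nat_lit 56, nat_lit 8, nat_lit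 1011062522981122048)]),
   (nat_lit 4, [(nat_lit 15, nat_lit 15, nat_lit 270215986248974400), (nat_lit 23, nat_lit 7, nat_lit 414335563781406784), (nat_lit 27, nat_lit 11, nat_lit 486393166392492096), (nat_lit 29, nat_lit 13, nat_lit 522421963428200512), (nat_lit 30, nat_lit 14, nat_lit 540436361937715200), (nat_lit 39, nat_lit 7, nat_lit 704813341700292672), (nat_lit 43, nat_lit 11, nat_lit 776870944311377984), (nat_lit 45, nat_lit 13, nat_lit 812899741347086400), (nat_lit 46, nat_lit 14, nat_lit 830914139856601088), (nat_lit 51, nat_lit 3, nat_lit 920990521843810368), (nat_lit 53, nat_lit 5, nat_lit 957019318879518784), (nat_lit 54, nat_lit 6, nat_lit 975033717389033472), (nat_lit 57, nat_lit 9, nat_lit 1029076921490604096), (nat_lit 58, nat_lit 10, nat_lit 1047091320000118784), (nat_lit 60, nat_lit 12, nat_lit 1083120117035827200)]),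
   (nat_lit 5, [(nat_lit 31, nat_lit 15, nat_lit 558450760447197248), (nat_lit 47, nat_lit 15, nat_lit 848928538366083136), (nat_lit 55, nat_lit 7, nat_lit 993048115898515520), (nat_lit 59, nat_lit 11, nat_lit 1065105718509600832), (nat_lit 61, nat_lit 13, nat_lit 1101134515545309248), (nat_lit 62, nat_lit 14, nat_lit 1119148914054823936)])]

def tb7 : List (ℕ × List (ℕ × ℕ × ℕ)) :=
  [(nat_lit 1, [(nat_lit 1, nat_lit 1, nat_lit 9223372036854775936), (nat_lit 2, nat_lit 2, nat_lit 18446744073709617152), (nat_lit 4, nat_lit 4, nat_lit 36893488147452657664), (nat_lit 8, nat_lit 8, nat_lit 73786976312018075648)]),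
   (nat_lit 2, [(nat_lit 3, nat_lit 3, nat_lit 27670116110564393088), (nat_lit 5, nat_lit 5, nat_lit 46116860184307433600), (nat_lit 6, nat_lit 6, nat_lit 55340232221162274816), (nat_lit 9, nat_lit 9, nat_lit 83010348348872851584), (nat_lit 10, nat_lit 10, nat_lit 92233720385727692800), (nat_lit 12, nat_lit 12, nat_lit 110680464459470733312), (nat_lit 17, nat_lit 1, nat_lit 156797333422624211072), (nat_lit 18, nat_lit 2, nat_lit 166020705459479052288), (nat_lit 20, nat_lit 4, nat_lit 184467449533222092800), (nat_lit 24, nat_lit 8, nat_lit 221360937697787510784), (nat_lit 33, nat_lit 1, nat_lit 304375780815834972288), (nat_lit 34, nat_lit 2, nat_lit 313599152852689813504), (nat_lit 36, nat_lit 4, nat_lit 332045896926432854016), (nat_lit 40, nat_lit 8, nat_lit 368939385090998272000), (nat_lit 65, nat_lit 1, nat_lit 601825025404774121600), (nat_lit 66, nat_lit 2, nat_lit 611048397441628962816), (nat_lit 68, nat_lit 4, nat_lit 629495141515372003328), (nat_lit 72, nat_lit 8, nat_lit 666388629679937421312)]),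
   (nat_lit 3, [(nat_lit 7, nat_lit 7, nat_lit 64563604258017050752), (nat_lit 11, nat_lit 11, nat_lit 101457092422582468736), (nat_lit 13, nat_lit 13, nat_lit 119903836496325509248), (nat_lit 14, nat_lit 14, nat_lit 129127208533180350464), (nat_lit 19, nat_lit 3, nat_lit 175244077496333828224), (nat_lit 21, nat_lit 5, nat_lit 193690821570076868736), (nat_lit 22, nat_lit 6, nat_lit 202914193606931709952), (nat_lit 25, nat_lit 9, nat_lit 230584309734642286720), (nat_lit 26, nat_lit 10, nat_lit 239807681771497127936), (nat_lit 28, nat_lit 12, nat_lit 258254425845240168448), (nat_lit 35, nat_lit 3, nat_lit 322822524889544589440), (nat_lit 37, nat_lit 5, nat_lit 341269268963287629952), (nat_lit 38, nat_lit 6, nat_lit 350492641000142471168), (nat_lit 41, nat_lit 9, nat_lit 378162757127853047936), (nat_lit 42, nat_lit 10, nat_lit 387386129164707889152), (nat_lit 44, nat_lit 12, nat_lit 405832873238450929664), (nat_lit 49, nat_lit 1, nat_lit 451949742201604407424), (nat_lit 50, nat_lit 2, nat_lit 461173114238459248640), (nat_lit 52, nat_lit 4, nat_lit 479619858312202289152),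 (nat_lit 56, nat_lit 8, nat_lit 516513346476767707136), (nat_lit 67, nat_lit 3, nat_lit 620271769478483738752), (nat_lit 69, nat_lit 5, nat_lit 638718513552226779264), (nat_lit 70, nat_lit 6, nat_lit 647941885589081620480), (nat_lit 73, nat_lit 9, nat_lit 675612001716792197248), (nat_lit 74, nat_lit 10, nat_lit 684835373753647038464), (nat_lit 76, nat_lit 12, nat_lit 703282117827390078976), (nat_lit 81, nat_lit 1, nat_lit 749398986790543556736), (nat_lit 82, nat_lit 2, nat_lit 758622358827398397952), (nat_lit 84, nat_lit 4, nat_lit 777069102901141438464), (nat_lit 88, nat_lit 8, nat_lit 813962591065706856448), (nat_lit 97, nat_lit 1, nat_lit 896977434183754317952), (nat_lit 98, nat_lit 2, nat_lit 906200806220609159168), (nat_lit 100, nat_lit 4, nat_lit 924647550294352199680), (nat_lit 104, nat_lit 8, nat_lit 961541038458917617664)]),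
   (nat_lit 4, [(nat_lit 15, nat_lit 15, nat_lit 138350580570035126400), (nat_lit 23, nat_lit 7, nat_lit 212137565643786485888), (nat_lit 27, nat_lit 11, nat_lit 249031053808351903872), (nat_lit 29, nat_lit 13, nat_lit 267477797882094944384), (nat_lit 30, nat_lit 14, nat_lit 276701169918949785600), (nat_lit 39, nat_lit 7, nat_lit 359716013036997247104), (nat_lit 43, nat_lit 11, nat_lit 396609501201562665088), (nat_lit 45, nat_lit 13, nat_lit 415056245275305705600), (nat_lit 46, nat_lit 14, nat_lit 424279617312160546816), (nat_lit 51, nat_lit 3, nat_lit 470396486275314024576), (nat_lit 53, nat_lit 5, nat_lit 488843230349057065088), (nat_lit 54, nat_lit 6, nat_lit 498066602385911906304), (nat_lit 57, nat_lit 9, nat_lit 525736718513622483072), (nat_lit 58, nat_lit 10, nat_lit 534960090550477324288), (nat_lit 60, nat_lit 12, nat_lit 553406834624220364800), (nat_lit 71, nat_lit 7, nat_lit 657165257625936396416), (nat_lit 75, nat_lit 11, nat_lit 694058745790501814400), (nat_lit 77, nat_lit 13, nat_lit 712505489864244854912), (nat_lit 78, nat_lit 14, nat_lit 721728861901099696128),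 (nat_lit 83, nat_lit 3, nat_lit 767845730864253173888), (nat_lit 85, nat_lit 5, nat_lit 786292474937996214400), (nat_lit 86, nat_lit 6, nat_lit 795515846974851055616), (nat_lit 89, nat_lit 9, nat_lit 823185963102561632384), (nat_lit 90, nat_lit 10, nat_lit 832409335139416473600), (nat_lit 92, nat_lit 12, nat_lit 850856079213159514112), (nat_lit 99, nat_lit 3, nat_lit 915424178257463935104), (nat_lit 101, nat_lit 5, nat_lit 933870922331206975616), (nat_lit 102, nat_lit 6, nat_lit 943094294368061816832), (nat_lit 105, nat_lit 9, nat_lit 970764410495772393600), (nat_lit 106, nat_lit 10, nat_lit 979987782532627234816), (nat_lit 108, nat_lit 12, nat_lit 998434526606370275328), (nat_lit 113, nat_lit 1, nat_lit 1044551395569523753088), (nat_lit 114, nat_lit 2, nat_lit 1053774767606378594304), (nat_lit 116, nat_lit 4, nat_lit 1072221511680121634816), (nat_lit 120, nat_lit 8, nat_lit 1109114999844687052800)]),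
   (nat_lit 5, [(nat_lit 31, nat_lit 15, nat_lit 285924541955804561536), (nat_lit 47, nat_lit 15, nat_lit 433502989349015322752), (nat_lit 55, nat_lit 7, nat_lit 507289974422766682240), (nat_lit 59, nat_lit 11, nat_lit 544183462587332100224), (nat_lit 61, nat_lit 13, nat_lit 562630206661075140736), (nat_lit 62, nat_lit 14, nat_lit 571853578697929981952), (nat_lit 79, nat_lit 15, nat_lit 730952233937954472064), (nat_lit 87, nat_lit 7, nat_lit 804739219011705831552), (nat_lit 91, nat_lit 11, nat_lit 841632707176271249536), (nat_lit 93, nat_lit 13, nat_lit 860079451250014290048), (nat_lit 94, nat_lit 14, nat_lit 869302823286869131264), (nat_lit 103, nat_lit 7, nat_lit 952317666404916592768), (nat_lit 107, nat_lit 11, nat_lit 989211154569482010752), (nat_lit 109, nat_lit 13, nat_lit 1007657898643225051264), (nat_lit 110, nat_lit 14, nat_lit 1016881270680079892480), (nat_lit 115, nat_lit 3, nat_lit 1062998139643233370240), (nat_lit 117, nat_lit 5, nat_lit 1081444883716976410752), (nat_lit 118, nat_lit 6, nat_lit 1090668255753831251968), (nat_lit 121, nat_lit 9, nat_lit 1118338371881541828736),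 (nat_lit 122, nat_lit 10, nat_lit 1127561743918396669952), (nat_lit 124, nat_lit 12, nat_lit 1146008487992139710464)])]

def tb8 : List (ℕ × List (ℕ × ℕ × ℕ)) :=
  [(nat_lit 1, [(nat_lit 1, nat_lit 1, nat_lit 4722366482869645213952), (nat_lit 2, nat_lit 2, nat_lit 9444732965739290558464), (nat_lit 4, nat_lit 4, nat_lit 18889465931478647963648), (nat_lit 8, nat_lit 8, nat_lit 37778931862991521447936)]),
   (nat_lit 2, [(nat_lit 3, nat_lit 3, nat_lit 14167099448608935772416), (nat_lit 5, nat_lit 5, nat_lit 23611832414348293177600), (nat_lit 6, nat_lit 6, nat_lit 28334198897217938522112), (nat_lit 9, nat_lit 9, nat_lit 42501298345861166661888), (nat_lit 10, nat_lit 10, nat_lit 47223664828730812006400), (nat_lit 12, nat_lit 12, nat_lit 56668397794470169411584), (nat_lit 17, nat_lit 1, nat_lit 80280230226376154677504), (nat_lit 18, nat_lit 2, nat_lit 85002596709245800022016), (nat_lit 20, nat_lit 4, nat_lit 94447329674985157427200), (nat_lit 24, nat_lit 8, nat_lit 113336795606498030911488), (nat_lit 33, nat_lit 1, nat_lit 155838102941897546793216),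 (nat_lit 34, nat_lit 2, nat_lit 160560469424767192137728), (nat_lit 36, nat_lit 4, nat_lit 170005202390506549542912), (nat_lit 40, nat_lit 8, nat_lit 188894668322019423027200), (nat_lit 65, nat_lit 1, nat_lit 306958433072545366278400), (nat_lit 66, nat_lit 2, nat_lit 311680799555415011622912), (nat_lit 68, nat_lit 4, nat_lit 321125532521154369028096), (nat_lit 72, nat_lit 8, nat_lit 340014998452667242512384), (nat_lit 129, nat_lit 1, nat_lit 611546459531619055173888), (nat_lit 130, nat_lit 2, nat_lit 616268826014488700518400), (nat_lit 132, nat_lit 4, nat_lit 625713558980228057923584), (nat_lit 136, nat_lit 8, nat_lit 644603024911740931407872)]),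
   (nat_lit 3, [(nat_lit 7, nat_lit 7, nat_lit 33056565380087583736064), (nat_lit 11, nat_lit 11, nat_lit 51946031311600457220352), (nat_lit 13, nat_lit 13, nat_lit 61390764277339814625536), (nat_lit 14, nat_lit 14, nat_lit 66113130760209459970048), (nat_lit 19, nat_lit 3, nat_lit 89724963192115445235968), (nat_lit 21, nat_lit 5, nat_lit 99169696157854802641152), (nat_lit 22, nat_lit 6, nat_lit 103892062640724447985664), (nat_lit 25, nat_lit 9, nat_lit 118059162089367676125440), (nat_lit 26, nat_lit 10, nat_lit 122781528572237321469952), (nat_lit 28, nat_lit 12, nat_lit 132226261537976678875136), (nat_lit 35, nat_lit 3, nat_lit 165282835907636837351680), (nat_lit 37, nat_lit 5, nat_lit 174727568873376194756864), (nat_lit 38, nat_lit 6, nat_lit 179449935356245840101376), (nat_lit 41, nat_lit 9, nat_lit 193617034804889068241152), (nat_lit 42, nat_lit 10, nat_lit 198339401287758713585664), (nat_lit 44, nat_lit 12, nat_lit 207784134253498070990848), (nat_lit 49, nat_lit 1, nat_lit 231395966685404056256768), (nat_lit 50, nat_lit 2, nat_lit 236118333168273701601280), (nat_lit 52, nat_lit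 4, nat_lit 245563066134013059006464), (nat_lit 56, nat_lit 8, nat_lit 264452532065525932490752), (nat_lit 67, nat_lit 3, nat_lit 316403166038284656836864), (nat_lit 69, nat_lit 5, nat_lit 325847899004024014242048), (nat_lit 70, nat_lit 6, nat_lit 330570265486893659586560), (nat_lit 73, nat_lit 9, nat_lit 344737364935536887726336), (nat_lit 74, nat_lit 10, nat_lit 349459731418406533070848), (nat_lit 76, nat_lit 12, nat_lit 358904464384145890476032), (nat_lit 81, nat_lit 1, nat_lit 382516296816051875741952), (nat_lit 82, nat_lit 2, nat_lit 387238663298921521086464), (nat_lit 84, nat_lit 4, nat_lit 396683396264660878491648), (nat_lit 88, nat_lit 8, nat_lit 415572862196173751975936), (nat_lit 97, nat_lit 1, nat_lit 458074169531573267857664), (nat_lit 98, nat_lit 2, nat_lit 462796536014442913202176), (nat_lit 100, nat_lit 4, nat_lit 472241268980182270607360), (nat_lit 104, nat_lit 8, nat_lit 491130734911695144091648), (nat_lit 131, nat_lit 3, nat_lit 620991192497358345732352), (nat_lit 133, nat_lit 5, nat_lit 630435925463097703137536), (nat_lit 134, nat_lit 6, nat_lit 635158291945967348482048), (nat_lit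 137, nat_lit 9, nat_lit 649325391394610576621824), (nat_lit 138, nat_lit 10, nat_lit 654047757877480221966336), (nat_lit 140, nat_lit 12, nat_lit 663492490843219579371520), (nat_lit 145, nat_lit 1, nat_lit 687104323275125564637440), (nat_lit 146, nat_lit 2, nat_lit 691826689757995209981952), (nat_lit 148, nat_lit 4, nat_lit 701271422723734567387136), (nat_lit 152, nat_lit 8, nat_lit 720160888655247440871424), (nat_lit 161, nat_lit 1, nat_lit 762662195990646956753152), (nat_lit 162, nat_lit 2, nat_lit 767384562473516602097664), (nat_lit 164, nat_lit 4, nat_lit 776829295439255959502848), (nat_lit 168, nat_lit 8, nat_lit 795718761370768832987136), (nat_lit 193, nat_lit 1, nat_lit 913782526121294776238336), (nat_lit 194, nat_lit 2, nat_lit 918504892604164421582848), (nat_lit 196, nat_lit 4, nat_lit 927949625569903778988032), (nat_lit 200, nat_lit 8, nat_lit 946839091501416652472320)]),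
   (nat_lit 4, [(nat_lit 15, nat_lit 15, nat_lit 70835497243079105184000), (nat_lit 23, nat_lit 7, nat_lit 108614429123594093199616), (nat_lit 27, nat_lit 11, nat_lit 127503895055106966683904), (nat_lit 29, nat_lit 13, nat_lit 136948628020846324089088), (nat_lit 30, nat_lit 14, nat_lit 141670994503715969433600), (nat_lit 39, nat_lit 7, nat_lit 184172301839115485315328), (nat_lit 43, nat_lit 11, nat_lit 203061767770628358799616), (nat_lit 45, nat_lit 13, nat_lit 212506500736367716204800), (nat_lit 46, nat_lit 14, nat_lit 217228867219237361549312), (nat_lit 51, nat_lit 3, nat_lit 240840699651143346815232), (nat_lit 53, nat_lit 5, nat_lit 250285432616882704220416), (nat_lit 54, nat_lit 6, nat_lit 255007799099752349564928), (nat_lit 57, nat_lit 9, nat_lit 269174898548395577704704), (nat_lit 58, nat_lit 10, nat_lit 273897265031265223049216), (nat_lit 60, nat_lit 12, nat_lit 283341997997004580454400), (nat_lit 71, nat_lit 7, nat_lit 335292631969763304800512), (nat_lit 75, nat_lit 11, nat_lit 354182097901276178284800), (nat_lit 77, nat_lit 13, nat_lit 363626830867015535689984), (nat_lit 78, nat_lit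 14, nat_lit 368349197349885181034496), (nat_lit 83, nat_lit 3, nat_lit 391961029781791166300416), (nat_lit 85, nat_lit 5, nat_lit 401405762747530523705600), (nat_lit 86, nat_lit 6, nat_lit 406128129230400169050112), (nat_lit 89, nat_lit 9, nat_lit 420295228679043397189888), (nat_lit 90, nat_lit 10, nat_lit 425017595161913042534400), (nat_lit 92, nat_lit 12, nat_lit 434462328127652399939584), (nat_lit 99, nat_lit 3, nat_lit 467518902497312558416128), (nat_lit 101, nat_lit 5, nat_lit 476963635463051915821312), (nat_lit 102, nat_lit 6, nat_lit 481686001945921561165824), (nat_lit 105, nat_lit 9, nat_lit 495853101394564789305600), (nat_lit 106, nat_lit 10, nat_lit 500575467877434434650112), (nat_lit 108, nat_lit 12, nat_lit 510020200843173792055296), (nat_lit 113, nat_lit 1, nat_lit 533632033275079777321216), (nat_lit 114, nat_lit 2, nat_lit 538354399757949422665728), (nat_lit 116, nat_lit 4, nat_lit 547799132723688780070912), (nat_lit 120, nat_lit 8, nat_lit 566688598655201653555200), (nat_lit 135, nat_lit 7, nat_lit 639880658428836993696000), (nat_lit 139, nat_lit 11, nat_lit 658770124360349867180288), (nat_lit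 141, nat_lit 13, nat_lit 668214857326089224585472), (nat_lit 142, nat_lit 14, nat_lit 672937223808958869929984), (nat_lit 147, nat_lit 3, nat_lit 696549056240864855195904), (nat_lit 149, nat_lit 5, nat_lit 705993789206604212601088), (nat_lit 150, nat_lit 6, nat_lit 710716155689473857945600), (nat_lit 153, nat_lit 9, nat_lit 724883255138117086085376), (nat_lit 154, nat_lit 10, nat_lit 729605621620986731429888), (nat_lit 156, nat_lit 12, nat_lit 739050354586726088835072), (nat_lit 163, nat_lit 3, nat_lit 772106928956386247311616), (nat_lit 165, nat_lit 5, nat_lit 781551661922125604716800), (nat_lit 166, nat_lit 6, nat_lit 786274028404995250061312), (nat_lit 169, nat_lit 9, nat_lit 800441127853638478201088), (nat_lit 170, nat_lit 10, nat_lit 805163494336508123545600), (nat_lit 172, nat_lit 12, nat_lit 814608227302247480950784), (nat_lit 177, nat_lit 1, nat_lit 838220059734153466216704), (nat_lit 178, nat_lit 2, nat_lit 842942426217023111561216), (nat_lit 180, nat_lit 4, nat_lit 852387159182762468966400), (nat_lit 184, nat_lit 8, nat_lit 871276625114275342450688), (nat_lit 195, nat_lit 3, nat_lit 923227259087034066796800),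 (nat_lit 197, nat_lit 5, nat_lit 932671992052773424201984), (nat_lit 198, nat_lit 6, nat_lit 937394358535643069546496), (nat_lit 201, nat_lit 9, nat_lit 951561457984286297686272), (nat_lit 202, nat_lit 10, nat_lit 956283824467155943030784), (nat_lit 204, nat_lit 12, nat_lit 965728557432895300435968), (nat_lit 209, nat_lit 1, nat_lit 989340389864801285701888), (nat_lit 210, nat_lit 2, nat_lit 994062756347670931046400), (nat_lit 212, nat_lit 4, nat_lit 1003507489313410288451584), (nat_lit 216, nat_lit 8, nat_lit 1022396955244923161935872), (nat_lit 225, nat_lit 1, nat_lit 1064898262580322677817600), (nat_lit 226, nat_lit 2, nat_lit 1069620629063192323162112), (nat_lit 228, nat_lit 4, nat_lit 1079065362028931680567296), (nat_lit 232, nat_lit 8, nat_lit 1097954827960444554051584)]),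
   (nat_lit 5, [(nat_lit 31, nat_lit 15, nat_lit 146393360986585614647552), (nat_lit 47, nat_lit 15, nat_lit 221951233702107006763264), (nat_lit 55, nat_lit 7, nat_lit 259730165582621994778880), (nat_lit 59, nat_lit 11, nat_lit 278619631514134868263168), (nat_lit 61, nat_lit 13, nat_lit 288064364479874225668352), (nat_lit 62, nat_lit 14, nat_lit 292786730962743871012864), (nat_lit 79, nat_lit 15, nat_lit 373071563832754826248448), (nat_lit 87, nat_lit 7, nat_lit 410850495713269814264064), (nat_lit 91, nat_lit 11, nat_lit 429739961644782687748352), (nat_lit 93, nat_lit 13, nat_lit 439184694610522045153536), (nat_lit 94, nat_lit 14, nat_lit 443907061093391690498048), (nat_lit 103, nat_lit 7, nat_lit 486408368428791206379776), (nat_lit 107, nat_lit 11, nat_lit 505297834360304079864064), (nat_lit 109, nat_lit 13, nat_lit 514742567326043437269248), (nat_lit 110, nat_lit 14, nat_lit 519464933808913082613760), (nat_lit 115, nat_lit 3, nat_lit 543076766240819067879680), (nat_lit 117, nat_lit 5, nat_lit 552521499206558425284864), (nat_lit 118, nat_lit 6, nat_lit 557243865689428070629376), (nat_lit 121, nat_lit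 9, nat_lit 571410965138071298769152), (nat_lit 122, nat_lit 10, nat_lit 576133331620940944113664), (nat_lit 124, nat_lit 12, nat_lit 585578064586680301518848), (nat_lit 143, nat_lit 15, nat_lit 677659590291828515143936), (nat_lit 151, nat_lit 7, nat_lit 715438522172343503159552), (nat_lit 155, nat_lit 11, nat_lit 734327988103856376643840), (nat_lit 157, nat_lit 13, nat_lit 743772721069595734049024), (nat_lit 158, nat_lit 14, nat_lit 748495087552465379393536), (nat_lit 167, nat_lit 7, nat_lit 790996394887864895275264), (nat_lit 171, nat_lit 11, nat_lit 809885860819377768759552), (nat_lit 173, nat_lit 13, nat_lit 819330593785117126164736), (nat_lit 174, nat_lit 14, nat_lit 824052960267986771509248), (nat_lit 179, nat_lit 3, nat_lit 847664792699892756775168), (nat_lit 181, nat_lit 5, nat_lit 857109525665632114180352), (nat_lit 182, nat_lit 6, nat_lit 861831892148501759524864), (nat_lit 185, nat_lit 9, nat_lit 875998991597144987664640), (nat_lit 186, nat_lit 10, nat_lit 880721358080014633009152), (nat_lit 188, nat_lit 12, nat_lit 890166091045753990414336), (nat_lit 199, nat_lit 7, nat_lit 942116725018512714760448), (nat_lit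 203, nat_lit 11, nat_lit 961006190950025588244736), (nat_lit 205, nat_lit 13, nat_lit 970450923915764945649920), (nat_lit 206, nat_lit 14, nat_lit 975173290398634590994432), (nat_lit 211, nat_lit 3, nat_lit 998785122830540576260352), (nat_lit 213, nat_lit 5, nat_lit 1008229855796279933665536), (nat_lit 214, nat_lit 6, nat_lit 1012952222279149579010048), (nat_lit 217, nat_lit 9, nat_lit 1027119321727792807149824), (nat_lit 218, nat_lit 10, nat_lit 1031841688210662452494336), (nat_lit 220, nat_lit 12, nat_lit 1041286421176401809899520), (nat_lit 227, nat_lit 3, nat_lit 1074342995546061968376064), (nat_lit 229, nat_lit 5, nat_lit 1083787728511801325781248), (nat_lit 230, nat_lit 6, nat_lit 1088510094994670971125760), (nat_lit 233, nat_lit 9, nat_lit 1102677194443314199265536), (nat_lit 234, nat_lit 10, nat_lit 1107399560926183844610048), (nat_lit 236, nat_lit 12, nat_lit 1116844293891923202015232), (nat_lit 241, nat_lit 1, nat_lit 1140456126323829187281152), (nat_lit 242, nat_lit 2, nat_lit 1145178492806698832625664), (nat_lit 244, nat_lit 4, nat_lit 1154623225772438190030848), (nat_lit 248, nat_lit 8,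 nat_lit 1173512691703951063515136)])]

noncomputable def search : List (ℕ × ℕ × List (ℕ × List (ℕ × ℕ × ℕ))) → ℕ → ℕ → List ℕ → List ℕ →
    List ℕ → List ℕ → ℕ → Bool
  | [], _, _, _, _, L3, L4, A =>
    ifB (Nat.beq (len L3 (nat_lit 0)) (nat_lit 30)) (ifB (Nat.beq (len L4 (nat_lit 0)) (nat_lit 9))
      (forceN A leafOK))
  | (n, w, T) :: Ts, prev, e, L1, L2, L3, L4, A =>
    allB (fun q =>
      ifB (Nat.ble (Nat.add (Nat.add e q.1) n) (nat_lit 9))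
      (ifB (Bool.rec true (Nat.beq (Nat.add e q.1) (nat_lit 9)) (Nat.beq n (nat_lit 0)))
        (allB (fun MM => Prod.rec (fun M mc => Prod.rec (fun m c =>
          ifB (Nat.ble prev m) (ifB (noDisj M L4)
          (force (ext M w L3 L4) fun L4' => ifB (lenLe L4' (nat_lit 9)) (
          force (ext M w L2 L3) fun L3' => ifB (lenLe L3' (nat_lit 30)) (
          force (ext M w L1 L2) fun L2' =>
            search Ts m (Nat.add e q.1) (w :: L1) L2' L3' L4' (Nat.lor A c)))))) mc) MM)
          q.2))) T

set_option maxRecDepth 100000 in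
set_option maxHeartbeats 0 in
theorem search_true : search
  [(nat_lit 4, nat_lit 16, tb4), (nat_lit 3, nat_lit 32, tb5), (nat_lit 2, nat_lit 64, tb6),
    (nat_lit 1, nat_lit 128, tb7), (nat_lit 0, nat_lit 256, tb8)] (nat_lit 0) (nat_lit 0)
  [nat_lit 8, nat_lit 4, nat_lit 2, nat_lit 1]
  [nat_lit 9, nat_lit 10, nat_lit 12, nat_lit 5, nat_lit 6, nat_lit 3]
  [nat_lit 11, nat_lit 14, nat_lit 13, nat_lit 7] [nat_lit 15] (nat_lit 0) = true := by decide +kernel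

/-! ### Specifications -/

theorem ext_cons (M w s : ℕ) (l B : List ℕ) :
    ext M w (s :: l) B = if Nat.land s M = 0 then ext M w l ((s + w) :: B) else ext M w l B := by
  have h0 : ext M w (s :: l) B = Bool.rec (motive := fun _ => List ℕ) (ext M w l B)
      (ext M w l ((s + w) :: B)) (Nat.beq (Nat.land s M) 0) := by
    cases h : Nat.beq (Nat.land s M) 0 with
    | false =>
      show Bool.rec (motive := fun _ => List ℕ) _ _ (Nat.beq (Nat.land s M) 0) = _
      rw [h]; rfl
    | true =>
      show Bool.rec (motive := fun _ => List ℕ) _ _ (Nat.beq (Nat.land s M) 0) = _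
      rw [h]; rfl
  rw [h0]
  cases h : Nat.beq (Nat.land s M) 0 with
  | false => rw [if_neg (Nat.ne_of_beq_eq_false h)]
  | true => rw [if_pos (Nat.eq_of_beq_eq_true h)]

theorem ext_perm (M w : ℕ) (A B : List ℕ) :
    (ext M w A B).Perm (B ++ (A.filter (fun s => decide (Nat.land s M = 0))).map (· + w)) := by
  induction A generalizing B with
  | nil => simp [ext]
  | cons s l ih =>
    rw [ext_cons, List.filter_cons]
    by_cases h : Nat.land s M = 0
    · simp only [h, if_true, decide_true, List.map_cons]
      refine (ih _).trans ?_
      rw [List.cons_append]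
      exact List.perm_middle.symm
    · simp only [h, if_false, decide_false]
      exact ih B

theorem len_eq (l : List ℕ) (n : ℕ) : len l n = n + l.length := by
  induction l generalizing n with
  | nil => rfl
  | cons a l ih =>
    show len l (n + 1) = _
    rw [ih]; simp; omega

theorem lenLe_eq (l : List ℕ) (n : ℕ) (h : l.length ≤ n) : lenLe l n = true := by
  induction l generalizing n with
  | nil => rfl
  | cons a l ih =>
    cases n with
    | zero => simp at h
    | succ m => exact ih m (by simpa using h)

theorem force_eq (l : List ℕ) (k : List ℕ → Bool) : force l k = k l := by
  cases l <;> rfl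

theorem forceN_eq {α : Type} (n : ℕ) (k : ℕ → α) : forceN n k = k n := by
  cases n <;> rfl

theorem ifB_true {b x : Bool} (h : ifB b x = true) (hb : b = true) : x = true := by
  subst hb; exact h

theorem allB_true {α : Type} {p : α → Bool} {l : List α} (h : allB p l = true) {a : α}
    (ha : a ∈ l) : p a = true := by
  induction l with
  | nil => simp at ha
  | cons b l ih =>
    have h' : Bool.rec (motive := fun _ => Bool) false (allB p l) (p b) = true := h
    cases hb : p b with
    | false => rw [hb] at h'; simp at h'
    | true =>
      rw [hb] at h'
      rcases List.mem_cons.1 ha with rfl | h2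
      · exact hb
      · exact ih h' h2

theorem noDisj_true (M : ℕ) (l : List ℕ) (h : ∀ s ∈ l, Nat.land s M ≠ 0) : noDisj M l = true := by
  induction l with
  | nil => rfl
  | cons b l ih =>
    show Bool.rec _ _ (Nat.beq (Nat.land b M) 0) = true
    have : Nat.beq (Nat.land b M) 0 = false := by
      have := h b (by simp)
      cases h2 : Nat.beq (Nat.land b M) 0 with
      | false => rfl
      | true => exact absurd (Nat.eq_of_beq_eq_true h2) this
    rw [this]
    exact ih (fun s hs => h s (by simp [hs]))

theorem bt_eq (A k : ℕ) : bt A k = A.testBit k := by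
  have h1 : bt A k = Nat.beq (1 &&& (A >>> k)) 1 := rfl
  have h2 : A.testBit k = ((1 &&& (A >>> k)) != 0) := rfl
  rw [h1, h2, Nat.one_and_eq_mod_two]
  rcases Nat.mod_two_eq_zero_or_one (A >>> k) with h | h <;> rw [h] <;> rfl

/-- the list of (codes of) independent `k`-subsets of the first `v` vertices -/
noncomputable def IL (r : ℕ → ℕ) : ℕ → ℕ → List ℕ
  | 0, 0 => [0]
  | 0, _ + 1 => []
  | _ + 1, 0 => [0]
  | v + 1, k + 1 => ext (r v) (2 ^ v) (IL r v k) (IL r v (k + 1))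

noncomputable def tm (s : Finset ℕ) : ℕ := ∑ i ∈ s, 2 ^ i

theorem tm_testBit (s : Finset ℕ) (i : ℕ) : (tm s).testBit i = true ↔ i ∈ s := by
  rw [← Nat.mem_bitIndices, ← List.mem_toFinset]
  unfold tm
  rw [Finset.toFinset_bitIndices_sum_two_pow]

theorem land_tm (s : Finset ℕ) (M : ℕ) :
    Nat.land (tm s) M = 0 ↔ ∀ i ∈ s, M.testBit i = false := by
  have : Nat.land (tm s) M = tm s &&& M := rfl
  rw [this]
  constructor
  · intro h i hi
    have := congrArg (fun n => Nat.testBit n i) h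
    simp only [Nat.testBit_and, Nat.zero_testBit, (tm_testBit s i).2 hi, Bool.true_and] at this
    exact this
  · intro h
    apply Nat.eq_of_testBit_eq
    intro i
    rw [Nat.testBit_and, Nat.zero_testBit]
    by_cases hi : i ∈ s
    · simp [h i hi]
    · have : (tm s).testBit i = false := by
        rw [← Bool.not_eq_true, tm_testBit]; exact hi
      simp [this]

def ind (r : ℕ → ℕ) (s : Finset ℕ) : Prop := ∀ i ∈ s, ∀ j ∈ s, i < j → (r j).testBit i = false

open scoped Classical in
noncomputable def fam (r : ℕ → ℕ) (v k : ℕ) : Finset (Finset ℕ) :=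
  ((Finset.range v).powersetCard k).filter (ind r)

open scoped Classical in
theorem fam_succ (r : ℕ → ℕ) (v k : ℕ) :
    (fam r (v + 1) (k + 1)).val = (fam r v (k + 1)).val +
      (((fam r v k).val.filter (fun s => Nat.land (tm s) (r v) = 0)).map (insert v)) := by
  have hv : ∀ s ∈ fam r v k, v ∉ s := by
    intro s hs h
    simp only [fam, Finset.mem_filter, Finset.mem_powersetCard] at hs
    have := hs.1.1 h
    simp at this
  have hinj : Set.InjOn (insert v) (((fam r v k).filter (fun s => Nat.land (tm s) (r v) = 0) : Finset (Finset ℕ)) : Set (Finset ℕ)) := by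
    intro s hs t ht h
    simp only [Finset.coe_filter, Set.mem_ofPred_eq] at hs ht
    have := congrArg (fun u => Finset.erase u v) h
    simpa [Finset.erase_insert (hv s hs.1), Finset.erase_insert (hv t ht.1)] using this
  have h1 : (((fam r v k).val.filter (fun s => Nat.land (tm s) (r v) = 0)).map (insert v)) =
      (((fam r v k).filter (fun s => Nat.land (tm s) (r v) = 0)).image (insert v)).val := by
    rw [Finset.image_val_of_injOn hinj]; rfl
  have hd : Disjoint (fam r v (k + 1))
      (((fam r v k).filter (fun s => Nat.land (tm s) (r v) = 0)).image (insert v)) := by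
    rw [Finset.disjoint_left]
    intro s hs ht
    simp only [Finset.mem_image] at ht
    obtain ⟨t, -, rfl⟩ := ht
    simp only [fam, Finset.mem_filter, Finset.mem_powersetCard] at hs
    have := hs.1.1 (Finset.mem_insert_self v t)
    simp at this
  rw [h1]
  have h2 : fam r (v + 1) (k + 1) = (fam r v (k + 1)).disjUnion _ hd := by
    rw [Finset.disjUnion_eq_union]
    ext s
    simp only [fam, Finset.mem_filter, Finset.mem_union, Finset.mem_image, Finset.range_add_one]
    rw [Finset.powersetCard_succ_insert (by simp)]
    simp only [Finset.mem_union, Finset.mem_image]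
    constructor
    · rintro ⟨h | ⟨t, ht, rfl⟩, hi⟩
      · exact Or.inl ⟨h, hi⟩
      · refine Or.inr ⟨t, ⟨⟨ht, ?_⟩, ?_⟩, rfl⟩
        · intro i hi' j hj; exact hi i (by simp [hi']) j (by simp [hj])
        · rw [land_tm]
          intro i hit
          refine hi i (by simp [hit]) v (by simp) ?_
          simpa using (Finset.mem_powersetCard.1 ht).1 hit
    · rintro (⟨h, hi⟩ | ⟨t, ⟨⟨ht, hi⟩, hl⟩, rfl⟩)
      · exact ⟨Or.inl h, hi⟩
      · refine ⟨Or.inr ⟨t, ht, rfl⟩, ?_⟩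
        rw [land_tm] at hl
        have hlt : ∀ i ∈ t, i < v := fun i hit => by
          simpa using (Finset.mem_powersetCard.1 ht).1 hit
        intro i hi' j hj hij
        rcases Finset.mem_insert.1 hj with rfl | hj'
        · rcases Finset.mem_insert.1 hi' with rfl | hi'
          · exact absurd hij (lt_irrefl _)
          · exact hl i hi'
        · rcases Finset.mem_insert.1 hi' with rfl | hi'
          · exact absurd (hlt j hj') (by omega)
          · exact hi i hi' j hj' hij
  rw [h2]; rfl

theorem IL_eq (r : ℕ → ℕ) (v k : ℕ) : (fam r v k).val.map tm = (IL r v k : Multiset ℕ) := by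
  induction v generalizing k with
  | zero =>
    cases k with
    | zero =>
      have : fam r 0 0 = {∅} := by
        ext s; simp [fam, ind]; rintro rfl; simp
      rw [this]; simp [IL, tm]
    | succ k =>
      have : fam r 0 (k + 1) = ∅ := by
        simp [fam]
      rw [this]; simp [IL]
  | succ v ih =>
    cases k with
    | zero =>
      have : fam r (v + 1) 0 = {∅} := by
        ext s; simp [fam, ind]; rintro rfl; simp
      rw [this]; simp [IL, tm]
    | succ k =>
      classical
      rw [fam_succ, Multiset.map_add]
      simp only [IL]
      have h := ext_perm (r v) (2 ^ v) (IL r v k) (IL r v (k + 1))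
      rw [Multiset.coe_eq_coe.2 h, ← Multiset.coe_add, ← Multiset.map_coe, ← Multiset.filter_coe, ← ih k, ← ih (k + 1),
        Multiset.filter_map, Multiset.map_map, Multiset.map_map]
      congr 1
      have hv : ∀ s ∈ fam r v k, v ∉ s := by
        intro s hs h
        simp only [fam, Finset.mem_filter, Finset.mem_powersetCard] at hs
        have := hs.1.1 h
        simp at this
      have h3 : (fam r v k).val.filter (fun s => Nat.land (tm s) (r v) = 0) =
          (fam r v k).val.filter ((fun s => Nat.land s (r v) = 0) ∘ tm) := by
        apply Multiset.filter_congr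
        intro s _
        simp
      rw [h3]
      apply Multiset.map_congr rfl
      intro s hs
      have := hv s (Multiset.mem_of_mem_filter hs)
      simp [tm, Finset.sum_insert this, add_comm]

theorem IL_length (r : ℕ → ℕ) (v k : ℕ) : (IL r v k).length = (fam r v k).card := by
  have := congrArg Multiset.card (IL_eq r v k)
  simpa using this.symm

section poly
variable {V W : Type*} [Fintype V] [Fintype W]

open scoped Classical in
theorem coeff_indepPoly (G : SimpleGraph V) (k : ℕ) :
    G.indepPoly.coeff k =
      ((Finset.univ.filter (fun s : Finset V => G.IsIndepFinset s ∧ s.card = k)).card : ℚ) := by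
  unfold SimpleGraph.indepPoly
  rw [Polynomial.finsetSum_coeff, Finset.card_filter]
  push_cast
  apply Finset.sum_congr rfl
  intro s _
  by_cases h : G.IsIndepFinset s
  · simp [h, Polynomial.coeff_X_pow, eq_comm]
  · simp [h]

theorem indepPoly_iso {G : SimpleGraph V} {G' : SimpleGraph W} (e : G ≃g G') :
    G.indepPoly = G'.indepPoly := by
  classical
  unfold SimpleGraph.indepPoly
  refine Fintype.sum_equiv e.toEquiv.finsetCongr _ _ ?_
  intro s
  have h : G'.IsIndepFinset (e.toEquiv.finsetCongr s) ↔ G.IsIndepFinset s := by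
    simp only [SimpleGraph.IsIndepFinset, Equiv.finsetCongr_apply, Finset.mem_map]
    constructor
    · intro h v hv w hw hvw
      exact h _ ⟨v, hv, rfl⟩ _ ⟨w, hw, rfl⟩ (e.map_adj_iff.2 hvw)
    · rintro h _ ⟨v, hv, rfl⟩ _ ⟨w, hw, rfl⟩ hvw
      exact h v hv w hw (e.map_adj_iff.1 hvw)
  by_cases hG : G.IsIndepFinset s
  · rw [if_pos hG, if_pos (h.2 hG), Equiv.finsetCongr_apply, Finset.card_map]
  · rw [if_neg hG, if_neg (fun h' => hG (h.1 h'))]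

theorem coeff_one (G : SimpleGraph V) : G.indepPoly.coeff 1 = Fintype.card V := by
  classical
  rw [coeff_indepPoly]
  congr 1
  have : (Finset.univ.filter (fun s : Finset V => G.IsIndepFinset s ∧ s.card = 1)) =
      Finset.univ.powersetCard 1 := by
    ext s
    simp only [Finset.mem_filter, Finset.mem_univ, true_and, Finset.mem_powersetCard,
      Finset.subset_univ, and_iff_right_iff_imp]
    intro h
    obtain ⟨a, rfl⟩ := Finset.card_eq_one.1 h
    simp [SimpleGraph.IsIndepFinset]
  rw [this, Finset.card_powersetCard]
  simp

end poly

theorem coeff_IL (G : SimpleGraph (Fin 9)) (r : ℕ → ℕ)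
    (hr : ∀ i j : Fin 9, i < j → ((r j).testBit i = true ↔ G.Adj i j)) (k : ℕ) :
    G.indepPoly.coeff k = ((IL r 9 k).length : ℚ) := by
  classical
  rw [coeff_indepPoly, IL_length]
  congr 1
  have hiff : ∀ s : Finset (Fin 9), ind r (s.map Fin.valEmbedding) ↔ G.IsIndepFinset s := by
    intro s
    simp only [ind, Finset.mem_map, SimpleGraph.IsIndepFinset]
    constructor
    · intro h v hv w hw hvw
      rcases lt_trichotomy v w with hlt | rfl | hlt
      · have := h _ ⟨v, hv, rfl⟩ _ ⟨w, hw, rfl⟩ hlt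
        have h2 := (hr v w hlt).2 hvw
        simp only [Fin.valEmbedding_apply] at this
        rw [h2] at this; cases this
      · exact G.loopless.irrefl _ hvw
      · have := h _ ⟨w, hw, rfl⟩ _ ⟨v, hv, rfl⟩ hlt
        have h2 := (hr w v hlt).2 hvw.symm
        simp only [Fin.valEmbedding_apply] at this
        rw [h2] at this; cases this
    · rintro h _ ⟨v, hv, rfl⟩ _ ⟨w, hw, rfl⟩ hlt
      rw [← Bool.not_eq_true]
      intro h2
      exact h v hv w hw ((hr v w hlt).1 h2)
  refine Finset.card_bij (fun s _ => s.map Fin.valEmbedding) ?_ ?_ ?_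
  · intro s hs
    simp only [Finset.mem_filter, Finset.mem_univ, true_and] at hs
    simp only [fam, Finset.mem_filter, Finset.mem_powersetCard, Finset.card_map, hiff]
    refine ⟨⟨?_, hs.2⟩, hs.1⟩
    intro x hx
    obtain ⟨y, -, rfl⟩ := Finset.mem_map.1 hx
    simp
  · intro s _ t _ h
    exact Finset.map_injective _ h
  · intro t ht
    simp only [fam, Finset.mem_filter, Finset.mem_powersetCard] at ht
    have hlt : ∀ x ∈ t, x < 9 := fun x hx => by simpa using ht.1.1 hx
    have hm : (t.attachFin hlt).map Fin.valEmbedding = t := by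
      ext x
      simp only [Finset.mem_map, Finset.mem_attachFin, Fin.valEmbedding_apply]
      constructor
      · rintro ⟨y, hy, rfl⟩; exact hy
      · intro hx; exact ⟨⟨x, hlt x hx⟩, hx, rfl⟩
    refine ⟨t.attachFin hlt, ?_, hm⟩
    simp only [Finset.mem_filter, Finset.mem_univ, true_and]
    refine ⟨?_, ?_⟩
    · rw [← hiff, hm]; exact ht.2
    · rw [Finset.card_attachFin]; exact ht.1.2

/-- the target graphs -/
def GT (T : ℕ) : SimpleGraph (Fin 9) :=
  SimpleGraph.fromRel (fun i j : Fin 9 => j < i ∧ T.testBit (9 * i + j) = true)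

instance (T : ℕ) : DecidableRel (GT T).Adj := fun i j =>
  decidable_of_iff (i ≠ j ∧ ((j < i ∧ T.testBit (9 * i + j) = true) ∨
    (i < j ∧ T.testBit (9 * j + i) = true))) (by simp [GT])

theorem GT_adj (T : ℕ) (i j : Fin 9) (h : j < i) :
    (GT T).Adj i j ↔ T.testBit (9 * i + j) = true := by
  simp only [GT, SimpleGraph.fromRel_adj]
  constructor
  · rintro ⟨-, h1 | h1⟩
    · exact h1.2
    · exact absurd h1.1 (not_lt_of_gt h)
  · intro h1
    exact ⟨(ne_of_lt h).symm, Or.inl ⟨h, h1⟩⟩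

def rT (T v : ℕ) : ℕ := Nat.mod (Nat.shiftRight T (9 * v)) (2 ^ v)

theorem rT_spec (T : ℕ) (i j : Fin 9) (h : i < j) :
    (rT T j).testBit i = true ↔ (GT T).Adj i j := by
  rw [SimpleGraph.adj_comm, GT_adj T j i h]
  have : rT T j = (T >>> (9 * (j : ℕ))) % 2 ^ (j : ℕ) := rfl
  rw [this, Nat.testBit_mod_two_pow, Nat.testBit_shiftRight]
  have h' : (i : ℕ) < j := h
  simp [h']

def c9 (k : ℕ) : ℕ := [1, 9, 27, 30, 9].getD k 0

def chkPoly (T : ℕ) : Prop := ∀ k < 10, (IL (rT T) 9 k).length = c9 k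

theorem coeff_GT (T : ℕ) (h : chkPoly T) (k : ℕ) : (GT T).indepPoly.coeff k = (c9 k : ℚ) := by
  rw [coeff_IL (GT T) (rT T) (rT_spec T)]
  congr 1
  by_cases hk : k < 10
  · exact h k hk
  · rw [IL_length, Finset.card_eq_zero.2]
    · unfold c9; rw [List.getD_eq_default]; simp; omega
    · classical
      unfold fam
      rw [Finset.powersetCard_eq_empty.2 (by simp; omega)]
      simp

set_option maxRecDepth 10000 in
theorem pC : chkPoly tC := by unfold chkPoly; decide +kernel
set_option maxRecDepth 10000 in
theorem pD : chkPoly tD := by unfold chkPoly; decide +kernel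
set_option maxRecDepth 10000 in
theorem pA : chkPoly tA := by unfold chkPoly; decide +kernel
set_option maxRecDepth 10000 in
theorem pE12 : chkPoly tE12 := by unfold chkPoly; decide +kernel
set_option maxRecDepth 10000 in
theorem pE21 : chkPoly tE21 := by unfold chkPoly; decide +kernel
set_option maxRecDepth 10000 in
theorem pB : chkPoly tB := by unfold chkPoly; decide +kernel

instance instDecFromRel {n : ℕ} (R : Fin n → Fin n → Prop) [DecidableRel R] :
    DecidableRel (SimpleGraph.fromRel R).Adj := fun i j =>
  decidable_of_iff (i ≠ j ∧ (R i j ∨ R j i)) (by simp)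

theorem isoOf {V W : Type} {G : SimpleGraph V} {G' : SimpleGraph W} [Fintype V] [Fintype W]
    (f : V → W) (hc : Fintype.card V = Fintype.card W) (hf : Function.Injective f)
    (h : ∀ a b, G'.Adj (f a) (f b) ↔ G.Adj a b) : Nonempty (G ≃g G') := by
  have hb : Function.Bijective f := (Fintype.bijective_iff_injective_and_card f).2 ⟨hf, hc⟩
  exact ⟨{ toEquiv := Equiv.ofBijective f hb, map_rel_iff' := by intro a b; exact h a b }⟩

theorem isoC : Nonempty (cycleGraph 9 ≃g GT tC) :=
  isoOf id rfl Function.injective_id (by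
    simp only [SimpleGraph.cycleGraph_adj', id]; decide +kernel)

theorem isoD : Nonempty (Dgraph 9 ≃g GT tD) :=
  isoOf Fin.rev rfl Fin.rev_injective (by
    unfold Dgraph; decide +kernel)

theorem isoSum {X : SimpleGraph (Fin 6)} {T : ℕ} (f : Fin 6 → Fin 9)
    (hf : ∀ a b, f a = f b → a = b) (hf6 : ∀ a, f a < 6)
    (h1 : ∀ a b, (GT T).Adj (f a) (f b) ↔ X.Adj a b)
    (h2 : ∀ a b : Fin 9, a < 6 → 6 ≤ b → ¬ (GT T).Adj a b)
    (h3 : ∀ a b : Fin 9, 6 ≤ a → 6 ≤ b → a ≠ b → (GT T).Adj a b) :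
    Nonempty (cycleGraph 3 ⊕g X ≃g GT T) := by
  have hn : ∀ a : Fin 3, (6 : Fin 9) ≤ Fin.natAdd 6 a := by decide
  have hi : ∀ a b : Fin 3, (Fin.natAdd 6 a : Fin 9) = Fin.natAdd 6 b → a = b := by decide
  refine isoOf (Sum.elim (Fin.natAdd 6) f) rfl ?_ ?_
  · rintro (a | a) (b | b) h
    · rw [hi a b h]
    · exact absurd (hf6 b) (not_lt_of_ge (by rw [← show Fin.natAdd 6 a = f b from h]; exact hn a))
    · exact absurd (hf6 a) (not_lt_of_ge (by rw [show f a = Fin.natAdd 6 b from h]; exact hn b))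
    · rw [hf a b h]
  · rintro (a | a) (b | b)
    · simp only [Sum.elim_inl, SimpleGraph.sum_adj_inl]
      by_cases hab : a = b
      · subst hab; simp
      · have : (cycleGraph 3).Adj a b := by
          revert hab; revert a b; simp only [SimpleGraph.cycleGraph_adj']; decide
        simp only [this, iff_true]
        exact h3 _ _ (hn a) (hn b) (fun h => hab (hi a b h))
    · simp only [Sum.elim_inl, Sum.elim_inr]
      constructor
      · intro h; exact absurd h.symm (h2 _ _ (hf6 b) (hn a))
      · intro h; exact absurd h (by simp)
    · simp only [Sum.elim_inl, Sum.elim_inr]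
      constructor
      · intro h; exact absurd h (h2 _ _ (hf6 a) (hn b))
      · intro h; exact absurd h (by simp)
    · simp only [Sum.elim_inr, SimpleGraph.sum_adj_inr]
      exact h1 a b

theorem isoA : Nonempty (cycleGraph 3 ⊕g Agraph 1 2 ≃g GT tA) :=
  isoSum (X := Agraph 1 2) ![5, 3, 2, 1, 0, 4] (by decide +kernel) (by decide +kernel)
    (by unfold Agraph; decide +kernel) (by decide +kernel) (by decide +kernel)

theorem isoE12 : Nonempty (cycleGraph 3 ⊕g Egraph 1 2 ≃g GT tE12) :=
  isoSum (X := Egraph 1 2) ![2, 3, 4, 5, 1, 0] (by decide +kernel) (by decide +kernel)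
    (by unfold Egraph; decide +kernel) (by decide +kernel) (by decide +kernel)

theorem isoE21 : Nonempty (cycleGraph 3 ⊕g Egraph 2 1 ≃g GT tE21) :=
  isoSum (X := Egraph 2 1) ![1, 2, 3, 4, 5, 0] (by decide +kernel) (by decide +kernel)
    (by unfold Egraph; decide +kernel) (by decide +kernel) (by decide +kernel)

theorem isoB : Nonempty (cycleGraph 3 ⊕g Bgraph 0 1 1 ≃g GT tB) :=
  isoSum (X := Bgraph 0 1 1) ![4, 5, 3, 1, 0, 2] (by decide +kernel) (by decide +kernel)
    (by unfold Bgraph; decide +kernel) (by decide +kernel) (by decide +kernel)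

theorem step {n w : ℕ} {T : List (ℕ × List (ℕ × ℕ × ℕ))}
    {Ts : List (ℕ × ℕ × List (ℕ × List (ℕ × ℕ × ℕ)))} {prev e : ℕ} {L1 L2 L3 L4 : List ℕ} {A : ℕ}
    (h : search ((n, w, T) :: Ts) prev e L1 L2 L3 L4 A = true)
    {q : ℕ × List (ℕ × ℕ × ℕ)} (hq : q ∈ T) {M m c : ℕ} (hM : (M, m, c) ∈ q.2)
    (h1 : e + q.1 + n ≤ 9) (h2 : n = 0 → e + q.1 = 9) (h3 : prev ≤ m) (h4 : noDisj M L4 = true)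
    (h5 : (ext M w L3 L4).length ≤ 9) (h6 : (ext M w L2 L3).length ≤ 30) :
    search Ts m (e + q.1) (w :: L1) (ext M w L1 L2) (ext M w L2 L3) (ext M w L3 L4) (A ||| c)
      = true := by
  rw [search] at h
  have h := allB_true h hq
  have h := ifB_true h (Nat.ble_eq_true_of_le h1)
  have h := ifB_true h (by
    cases hn : Nat.beq n 0 with
    | false => rfl
    | true =>
      have := h2 (Nat.eq_of_beq_eq_true hn)
      show Nat.beq (e + q.1) 9 = true
      rw [this]; rfl)
  have h := allB_true h hM
  have h := ifB_true h (Nat.ble_eq_true_of_le h3)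
  have h := ifB_true h h4
  rw [force_eq] at h
  have h := ifB_true h (lenLe_eq _ _ h5)
  rw [force_eq] at h
  have h := ifB_true h (lenLe_eq _ _ h6)
  rw [force_eq] at h
  exact h

theorem leaf_of {prev e : ℕ} {L1 L2 L3 L4 : List ℕ} {A : ℕ}
    (h : search [] prev e L1 L2 L3 L4 A = true) (h3 : L3.length = 30) (h4 : L4.length = 9) :
    leafOK A = true := by
  rw [search] at h
  have h := ifB_true h (by rw [len_eq, h3]; rfl)
  have h := ifB_true h (by rw [len_eq, h4]; rfl)
  rw [forceN_eq] at h
  exact h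

theorem orB_true {a b : Bool} (h : orB a b = true) : a = true ∨ b = true := by
  cases a
  · exact Or.inr h
  · exact Or.inl rfl

theorem andB_true {a b : Bool} (h : andB a b = true) : a = true ∧ b = true := by
  cases a
  · cases h
  · exact ⟨rfl, h⟩

theorem allLt_true {p : ℕ → Bool} {n : ℕ} (h : allLt p n = true) {i : ℕ} (hi : i < n) :
    p i = true := by
  induction n with
  | zero => omega
  | succ m ih =>
    have h' : Bool.rec (motive := fun _ => Bool) false (allLt p m) (p m) = true := h
    cases hb : p m with
    | false => rw [hb] at h'; cases h'
    | true =>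
      rw [hb] at h'
      rcases Nat.lt_succ_iff_lt_or_eq.1 hi with h2 | rfl
      · exact ih h' h2
      · exact hb

theorem chkIso_true {A T : ℕ} {p : List ℕ} (h : chkIso A T p = true) {i : ℕ} (hi : i < 9) :
    nth p i < 9 ∧ ∀ j < i, nth p i ≠ nth p j ∧
      A.testBit (9 * nth p i + nth p j) = T.testBit (9 * i + j) := by
  have h := allLt_true h hi
  rw [forceN_eq] at h
  obtain ⟨h1, h2⟩ := andB_true h
  refine ⟨Nat.lt_succ_of_le (Nat.le_of_ble_eq_true h1), fun j hj => ?_⟩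
  have h := allLt_true h2 hj
  rw [forceN_eq] at h
  obtain ⟨h1, h2⟩ := andB_true h
  constructor
  · intro he
    rw [he, Nat.beq_refl] at h1
    cases h1
  · rw [bt_eq, bt_eq] at h2
    have e1 : Nat.add (Nat.mul 9 i) j = 9 * i + j := rfl
    have e2 : Nat.add (Nat.mul 9 (nth p i)) (nth p j) = 9 * nth p i + nth p j := rfl
    rw [e1, e2] at h2
    cases hA : A.testBit (9 * nth p i + nth p j) <;> rw [hA] at h2 <;>
      cases hT : T.testBit (9 * i + j) <;> rw [hT] at h2 <;> first | rfl | cases h2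

theorem iso_of_chk {A T : ℕ} {p : List ℕ} (h : chkIso A T p = true) (G : SimpleGraph (Fin 9))
    (hA : ∀ x y : Fin 9, A.testBit (9 * x + y) = true ↔ G.Adj x y) : Nonempty (GT T ≃g G) := by
  have hne : ∀ i j : Fin 9, j < i → nth p i ≠ nth p j := fun i j hij =>
    ((chkIso_true h i.2).2 j hij).1
  have hlt : ∀ i j : Fin 9, j < i → (G.Adj ⟨nth p i, (chkIso_true h i.2).1⟩
      ⟨nth p j, (chkIso_true h j.2).1⟩ ↔ (GT T).Adj i j) := by
    intro i j hij
    rw [GT_adj T i j hij, ← hA, ((chkIso_true h i.2).2 j hij).2]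
  refine isoOf (fun i : Fin 9 => (⟨nth p i, (chkIso_true h i.2).1⟩ : Fin 9)) rfl ?_ ?_
  · intro i j hij
    have hij' : nth p i = nth p j := congrArg Fin.val hij
    rcases lt_trichotomy i j with h1 | h1 | h1
    · exact absurd hij'.symm (hne j i h1)
    · exact h1
    · exact absurd hij' (hne i j h1)
  · intro i j
    rcases lt_trichotomy i j with h1 | h1 | h1
    · rw [SimpleGraph.adj_comm, SimpleGraph.adj_comm (GT T)]
      exact hlt j i h1
    · subst h1; simp
    · exact hlt i j h1

theorem isoOK_true {rows : List (ℕ × ℕ × ℕ)} {A T : ℕ} {Th : List (ℕ × List Bool)}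
    (h : isoOK rows A T Th = true) : ∃ p, chkIso A T p = true := by
  unfold isoOK at h
  cases hp : place rows Th [] (nat_lit 0) with
  | none => rw [hp] at h; cases h
  | some p => rw [hp] at h; exact ⟨p, h⟩

theorem mkRows_true (A : ℕ) (vs : List ℕ) (k : List (ℕ × ℕ × ℕ) → Bool)
    (h : mkRows A vs k = true) : ∃ rows, k rows = true := by
  induction vs generalizing k with
  | nil => exact ⟨[], h⟩
  | cons x vs ih =>
    have h' : forceN (Nat.mod (Nat.shiftRight A (Nat.mul (nat_lit 9) x)) (nat_lit 512))
      (fun N => forceN (pc9 N) (fun d => mkRows A vs (fun l => k ((x, N, d) :: l)))) = true := h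
    rw [forceN_eq, forceN_eq] at h'
    obtain ⟨rows, hr⟩ := ih _ h'
    exact ⟨_, hr⟩

theorem leafOK_true {A : ℕ} (h : leafOK A = true) :
    ∃ T ∈ [tC, tD, tA, tE12, tE21, tB], ∃ p, chkIso A T p = true := by
  obtain ⟨rows, h⟩ := mkRows_true _ _ _ h
  rcases orB_true h with h | h
  · exact ⟨tD, by simp, isoOK_true h⟩
  rcases orB_true h with h | h
  · exact ⟨tA, by simp, isoOK_true h⟩
  rcases orB_true h with h | h
  · exact ⟨tE12, by simp, isoOK_true h⟩
  rcases orB_true h with h | h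
  · exact ⟨tE21, by simp, isoOK_true h⟩
  rcases orB_true h with h | h
  · exact ⟨tB, by simp, isoOK_true h⟩
  · exact ⟨tC, by simp, isoOK_true h⟩

def ones : ℕ → List ℕ
  | 0 => []
  | v + 1 => 2 ^ v :: ones v

def pcl (v M : ℕ) : ℕ := ((ones v).filter (fun s => decide (¬ Nat.land s M = 0))).length

def chkc (v M c : ℕ) : Bool :=
  (List.range 9).all fun x => (List.range 9).all fun y =>
    c.testBit (9 * x + y) == ((x == v && M.testBit y) || (y == v && M.testBit x))

def covers (v : ℕ) (T : List (ℕ × List (ℕ × ℕ × ℕ))) : Bool :=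
  (List.range (2 ^ v)).all fun M => M % 16 == 0 || (Nat.ble 1 (pcl v M) && (Nat.ble 6 (pcl v M) ||
    T.any (fun q => q.1 == pcl v M && q.2.any (fun t => t.1 == M && (t.2.1 == M % 16 &&
      chkc v M t.2.2)))))

set_option maxRecDepth 100000 in
theorem cov4 : covers 4 tb4 = true := by decide +kernel
set_option maxRecDepth 100000 in
theorem cov5 : covers 5 tb5 = true := by decide +kernel
set_option maxRecDepth 100000 in
theorem cov6 : covers 6 tb6 = true := by decide +kernel
set_option maxRecDepth 100000 in
theorem cov7 : covers 7 tb7 = true := by decide +kernel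
set_option maxRecDepth 100000 in
theorem cov8 : covers 8 tb8 = true := by decide +kernel

theorem covers_spec {v : ℕ} {T : List (ℕ × List (ℕ × ℕ × ℕ))} (h : covers v T = true) {M : ℕ}
    (hM : M < 2 ^ v) (h16 : M % 16 ≠ 0) : 1 ≤ pcl v M ∧ (pcl v M ≤ 5 → ∃ q ∈ T, q.1 = pcl v M ∧
      ∃ c, (M, M % 16, c) ∈ q.2 ∧ chkc v M c = true) := by
  unfold covers at h
  rw [List.all_eq_true] at h
  have h := h M (by simpa using hM)
  rw [Bool.or_eq_true] at h
  rcases h with h | h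
  · exact absurd (by simpa using h) h16
  rw [Bool.and_eq_true] at h
  refine ⟨Nat.le_of_ble_eq_true h.1, fun h5 => ?_⟩
  have h := h.2
  rw [Bool.or_eq_true] at h
  rcases h with h | h
  · exact absurd (Nat.le_of_ble_eq_true h) (by omega)
  rw [List.any_eq_true] at h
  obtain ⟨q, hq, h⟩ := h
  rw [Bool.and_eq_true, List.any_eq_true] at h
  obtain ⟨h1, ⟨M', m', c⟩, ht, h⟩ := h
  simp only [Bool.and_eq_true, beq_iff_eq] at h h1
  obtain ⟨rfl, rfl, h⟩ := h
  exact ⟨q, hq, h1, c, ht, h⟩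

theorem chkc_spec {v M c : ℕ} (h : chkc v M c = true) {x y : ℕ} (hx : x < 9) (hy : y < 9) :
    c.testBit (9 * x + y) = true ↔ (x = v ∧ M.testBit y = true) ∨ (y = v ∧ M.testBit x = true) := by
  unfold chkc at h
  rw [List.all_eq_true] at h
  have h := h x (by simpa using hx)
  rw [List.all_eq_true] at h
  have h := h y (by simpa using hy)
  rw [beq_iff_eq] at h
  rw [h]; simp

theorem IL_one (r : ℕ → ℕ) (v : ℕ) : IL r v 1 = ones v := by
  induction v with
  | zero => rfl
  | succ v ih =>
    have h0 : IL r v 0 = [0] := by cases v <;> rfl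
    show ext (r v) (2 ^ v) (IL r v 0) (IL r v 1) = _
    rw [h0, ih, ext_cons, if_pos (show Nat.land 0 (r v) = 0 from Nat.zero_and _)]
    show (0 + 2 ^ v) :: ones v = _
    rw [Nat.zero_add]; rfl

theorem ones_length (v : ℕ) : (ones v).length = v := by
  induction v with
  | zero => rfl
  | succ v ih => simp [ones, ih]

theorem IL_succ_length (r : ℕ → ℕ) (v k : ℕ) : (IL r (v + 1) (k + 1)).length =
    (IL r v (k + 1)).length +
      ((IL r v k).filter (fun s => decide (Nat.land s (r v) = 0))).length := by
  have := (ext_perm (r v) (2 ^ v) (IL r v k) (IL r v (k + 1))).length_eq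
  rw [List.length_append, List.length_map] at this
  exact this

theorem IL_two (r : ℕ → ℕ) (v : ℕ) :
    (IL r (v + 1) 2).length + pcl v (r v) = (IL r v 2).length + v := by
  have h1 : (IL r (v + 1) 2).length = (IL r v 2).length +
      ((IL r v 1).filter (fun s => decide (Nat.land s (r v) = 0))).length := IL_succ_length r v 1
  rw [h1, IL_one]
  have h : ∀ (l : List ℕ) (p : ℕ → Prop) [DecidablePred p],
      (l.filter (fun s => decide (p s))).length + (l.filter (fun s => decide (¬ p s))).length
        = l.length := by
    intro l p _
    induction l with
    | nil => rfl
    | cons a l ih =>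
      by_cases ha : p a <;> simp [ha] at ih ⊢ <;> omega
  have := h (ones v) (fun s => Nat.land s (r v) = 0)
  rw [ones_length] at this
  unfold pcl
  omega

theorem IL_mono (r : ℕ → ℕ) (k : ℕ) {v w : ℕ} (h : v ≤ w) :
    (IL r v (k + 1)).length ≤ (IL r w (k + 1)).length := by
  induction w, h using Nat.le_induction with
  | base => exact le_rfl
  | succ w _ ih => rw [IL_succ_length]; omega

theorem IL_sub (r : ℕ → ℕ) (k : ℕ) {v w : ℕ} (h : v ≤ w) {s : ℕ} (hs : s ∈ IL r v (k + 1)) :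
    s ∈ IL r w (k + 1) := by
  induction w, h using Nat.le_induction with
  | base => exact hs
  | succ w _ ih =>
    exact (ext_perm (r w) (2 ^ w) (IL r w k) (IL r w (k + 1))).mem_iff.2
      (List.mem_append_left _ ih)

theorem stepIL {r : ℕ → ℕ} (v v' n : ℕ) (hv' : v' = v + 1) {w : ℕ} {T : List (ℕ × List (ℕ × ℕ × ℕ))}
    {Ts : List (ℕ × ℕ × List (ℕ × List (ℕ × ℕ × ℕ)))} {prev e A : ℕ}
    (h : search ((n, w, T) :: Ts) prev e (IL r v 1) (IL r v 2) (IL r v 3) (IL r v 4) A = true)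
    (hw : w = 2 ^ v) (hT : covers v T = true) (hlt : r v < 2 ^ v) (h16 : r v % 16 ≠ 0)
    (h1 : e + pcl v (r v) + n ≤ 9) (h1' : pcl v (r v) ≤ 5)
    (h2 : n = 0 → e + pcl v (r v) = 9) (h3 : prev ≤ r v % 16)
    (h4 : ∀ s ∈ IL r v 4, Nat.land s (r v) ≠ 0)
    (h5 : (IL r v' 4).length ≤ 9) (h6 : (IL r v' 3).length ≤ 30) :
    ∃ c, chkc v (r v) c = true ∧ search Ts (r v % 16) (e + pcl v (r v)) (IL r v' 1)
      (IL r v' 2) (IL r v' 3) (IL r v' 4) (A ||| c) = true := by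
  subst hw
  subst hv'
  obtain ⟨-, hc⟩ := covers_spec hT hlt h16
  obtain ⟨q, hq, hq1, c, hc, hc'⟩ := hc h1'
  refine ⟨c, hc', ?_⟩
  have := step h hq hc (by rw [hq1]; exact h1) (by rw [hq1]; exact h2) h3 (noDisj_true _ _ h4) h5 h6
  rw [hq1] at this
  have e1 : IL r (v + 1) 1 = 2 ^ v :: IL r v 1 := by rw [IL_one, IL_one]; rfl
  rw [e1]
  exact this

theorem core (r : ℕ → ℕ) (h0 : ∀ v < 4, r v = 0) (hlt : ∀ v, 4 ≤ v → v < 9 → r v < 2 ^ v)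
    (hm : ∀ v, 4 ≤ v → v < 8 → r v % 16 ≤ r (v + 1) % 16)
    (l2 : (IL r 9 2).length = 27) (l3 : (IL r 9 3).length = 30) (l4 : (IL r 9 4).length = 9)
    (l5 : (IL r 9 5).length = 0) :
    ∃ A, leafOK A = true ∧ ∀ x < 9, ∀ y < 9, (A.testBit (9 * x + y) = true ↔
      ∃ v, 4 ≤ v ∧ v < 9 ∧ ((x = v ∧ (r v).testBit y = true) ∨
        (y = v ∧ (r v).testBit x = true))) := by
  have z0 := h0 0 (by norm_num)
  have z1 := h0 1 (by norm_num)
  have z2 := h0 2 (by norm_num)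
  have z3 := h0 3 (by norm_num)
  have i1 : IL r 4 1 = [8, 4, 2, 1] := by rw [IL_one]; rfl
  have i2 : IL r 4 2 = [9, 10, 12, 5, 6, 3] := by
    simp only [IL, z0, z1, z2, z3]; decide +kernel
  have i3 : IL r 4 3 = [11, 14, 13, 7] := by
    simp only [IL, z0, z1, z2, z3]; decide +kernel
  have i4 : IL r 4 4 = [15] := by
    simp only [IL, z0, z1, z2, z3]; decide +kernel
  have hd : ∀ v < 9, ∀ s ∈ IL r v 4, Nat.land s (r v) ≠ 0 := by
    intro v hv s hs hz
    have h1 := IL_mono r 4 (show v + 1 ≤ 9 by omega)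
    rw [l5, IL_succ_length] at h1
    have h2 : s ∈ (IL r v 4).filter (fun s => decide (Nat.land s (r v) = 0)) := by
      exact List.mem_filter.2 ⟨hs, decide_eq_true hz⟩
    have := List.length_pos_of_mem h2
    omega
  have h16 : ∀ v, 4 ≤ v → v < 9 → r v % 16 ≠ 0 := by
    intro v hv hv' hz
    have h15 : 15 ∈ IL r v 4 := IL_sub r 3 hv (by rw [i4]; simp)
    apply hd v hv' 15 h15
    have : Nat.land 15 (r v) = (r v) &&& (2 ^ 4 - 1) := Nat.and_comm _ _
    rw [this, Nat.and_two_pow_sub_one_eq_mod]; exact hz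
  have m4 : ∀ v < 9, (IL r (v + 1) 4).length ≤ 9 := fun v hv => by
    rw [← l4]; exact IL_mono r 3 (by omega)
  have m3 : ∀ v < 9, (IL r (v + 1) 3).length ≤ 30 := fun v hv => by
    rw [← l3]; exact IL_mono r 2 (by omega)
  have p4 := (covers_spec cov4 (hlt 4 (by norm_num) (by norm_num)) (h16 4 (by norm_num) (by norm_num))).1
  have p5 := (covers_spec cov5 (hlt 5 (by norm_num) (by norm_num)) (h16 5 (by norm_num) (by norm_num))).1
  have p6 := (covers_spec cov6 (hlt 6 (by norm_num) (by norm_num)) (h16 6 (by norm_num) (by norm_num))).1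
  have p7 := (covers_spec cov7 (hlt 7 (by norm_num) (by norm_num)) (h16 7 (by norm_num) (by norm_num))).1
  have p8 := (covers_spec cov8 (hlt 8 (by norm_num) (by norm_num)) (h16 8 (by norm_num) (by norm_num))).1
  have t4 := IL_two r 4
  have t5 := IL_two r 5
  have t6 := IL_two r 6
  have t7 := IL_two r 7
  have t8 := IL_two r 8
  have t3 : (IL r 4 2).length = 6 := by rw [i2]; rfl
  norm_num only at t4 t5 t6 t7 t8
  have S : search [(4, 16, tb4), (3, 32, tb5), (2, 64, tb6), (1, 128, tb7), (0, 256, tb8)] 0 0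
      (IL r 4 1) (IL r 4 2) (IL r 4 3) (IL r 4 4) 0 = true := by
    rw [i1, i2, i3, i4]; exact search_true
  obtain ⟨c4, k4, S⟩ := stepIL 4 5 4 rfl S rfl cov4 (hlt 4 (by norm_num) (by norm_num))
    (h16 4 (by norm_num) (by norm_num)) (by omega) (by omega) (by omega) (Nat.zero_le _)
    (hd 4 (by norm_num)) (m4 4 (by norm_num)) (m3 4 (by norm_num))
  obtain ⟨c5, k5, S⟩ := stepIL 5 6 3 rfl S rfl cov5 (hlt 5 (by norm_num) (by norm_num))
    (h16 5 (by norm_num) (by norm_num)) (by omega) (by omega) (by omega)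
    (hm 4 (by norm_num) (by norm_num))
    (hd 5 (by norm_num)) (m4 5 (by norm_num)) (m3 5 (by norm_num))
  obtain ⟨c6, k6, S⟩ := stepIL 6 7 2 rfl S rfl cov6 (hlt 6 (by norm_num) (by norm_num))
    (h16 6 (by norm_num) (by norm_num)) (by omega) (by omega) (by omega)
    (hm 5 (by norm_num) (by norm_num))
    (hd 6 (by norm_num)) (m4 6 (by norm_num)) (m3 6 (by norm_num))
  obtain ⟨c7, k7, S⟩ := stepIL 7 8 1 rfl S rfl cov7 (hlt 7 (by norm_num) (by norm_num))
    (h16 7 (by norm_num) (by norm_num)) (by omega) (by omega) (by omega)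
    (hm 6 (by norm_num) (by norm_num))
    (hd 7 (by norm_num)) (m4 7 (by norm_num)) (m3 7 (by norm_num))
  obtain ⟨c8, k8, S⟩ := stepIL 8 9 0 rfl S rfl cov8 (hlt 8 (by norm_num) (by norm_num))
    (h16 8 (by norm_num) (by norm_num)) (by omega) (by omega) (by omega)
    (hm 7 (by norm_num) (by norm_num))
    (hd 8 (by norm_num)) (m4 8 (by norm_num)) (m3 8 (by norm_num))
  refine ⟨_, leaf_of S l3 l4, ?_⟩
  intro x hx y hy
  simp only [Nat.testBit_or, Bool.or_eq_true, Nat.zero_testBit, chkc_spec k4 hx hy,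
    chkc_spec k5 hx hy, chkc_spec k6 hx hy, chkc_spec k7 hx hy, chkc_spec k8 hx hy]
  constructor
  · rintro (((((h | h) | h) | h) | h) | h)
    · cases h
    · exact ⟨4, by norm_num, by norm_num, h⟩
    · exact ⟨5, by norm_num, by norm_num, h⟩
    · exact ⟨6, by norm_num, by norm_num, h⟩
    · exact ⟨7, by norm_num, by norm_num, h⟩
    · exact ⟨8, by norm_num, by norm_num, h⟩
  · rintro ⟨v, hv4, hv9, h⟩
    have : v = 4 ∨ v = 5 ∨ v = 6 ∨ v = 7 ∨ v = 8 := by omega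
    rcases this with rfl | rfl | rfl | rfl | rfl
    · exact Or.inl (Or.inl (Or.inl (Or.inl (Or.inr h))))
    · exact Or.inl (Or.inl (Or.inl (Or.inr h)))
    · exact Or.inl (Or.inl (Or.inr h))
    · exact Or.inl (Or.inr h)
    · exact Or.inr h

theorem relabel (G : SimpleGraph (Fin 9)) (hS : ∀ i j : Fin 9, i.val < 4 → j.val < 4 → ¬ G.Adj i j)
    (r : ℕ → ℕ) (hr : ∀ i j : ℕ, (r j).testBit i = true ↔
      i < j ∧ ∃ (hi : i < 9) (hj : j < 9), G.Adj ⟨i, hi⟩ ⟨j, hj⟩)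
    (hm : ∀ v, 4 ≤ v → v < 8 → r v % 16 ≤ r (v + 1) % 16)
    (hc : ∀ k, G.indepPoly.coeff k = (c9 k : ℚ)) :
    ∃ T ∈ [tC, tD, tA, tE12, tE21, tB], Nonempty (GT T ≃g G) := by
  have hIL : ∀ k, (IL r 9 k).length = c9 k := by
    intro k
    have h := coeff_IL G r (fun i j hij => by
      rw [hr]
      exact ⟨fun ⟨_, _, _, h⟩ => h, fun h => ⟨hij, i.2, j.2, h⟩⟩) k
    rw [hc] at h
    exact_mod_cast h.symm
  have h0 : ∀ v < 4, r v = 0 := by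
    intro v hv
    apply Nat.eq_of_testBit_eq
    intro i
    rw [Nat.zero_testBit, Bool.eq_false_iff]
    intro h
    obtain ⟨h1, h2, h3, h4⟩ := (hr i v).1 h
    exact hS _ _ (show i < 4 by omega) hv h4
  have hlt : ∀ v, 4 ≤ v → v < 9 → r v < 2 ^ v := by
    intro v _ _
    apply Nat.lt_pow_two_of_testBit
    intro i hi
    rw [Bool.eq_false_iff]
    intro h
    have := ((hr i v).1 h).1
    omega
  obtain ⟨A, hA, hA'⟩ := core r h0 hlt hm (hIL 2) (hIL 3) (hIL 4) (hIL 5)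
  obtain ⟨T, hT, p, hp⟩ := leafOK_true hA
  refine ⟨T, hT, iso_of_chk hp G ?_⟩
  intro x y
  rw [hA' x x.2 y y.2]
  constructor
  · rintro ⟨v, hv4, hv9, ⟨rfl, h⟩ | ⟨rfl, h⟩⟩
    · obtain ⟨_, _, _, h⟩ := (hr _ _).1 h
      exact h.symm
    · obtain ⟨_, _, _, h⟩ := (hr _ _).1 h
      exact h
  · intro h
    have hne : x.val ≠ y.val := fun h' => h.ne (Fin.ext h')
    rcases lt_or_gt_of_ne hne with hl | hl
    · have : ¬ y.val < 4 := fun h4 => hS x y (by omega) h4 h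
      exact ⟨y, by omega, y.2, Or.inr ⟨rfl, (hr _ _).2 ⟨hl, x.2, y.2, h⟩⟩⟩
    · have : ¬ x.val < 4 := fun h4 => hS x y h4 (by omega) h
      exact ⟨x, by omega, x.2, Or.inl ⟨rfl, (hr _ _).2 ⟨hl, y.2, x.2, h.symm⟩⟩⟩

theorem forward {V : Type} [Fintype V] (H : SimpleGraph V)
    (hc : ∀ k, H.indepPoly.coeff k = (c9 k : ℚ)) :
    ∃ T ∈ [tC, tD, tA, tE12, tE21, tB], Nonempty (GT T ≃g H) := by
  classical
  have hV : Fintype.card V = 9 := by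
    have := hc 1
    rw [coeff_one] at this
    exact_mod_cast this
  obtain ⟨S, hS, hS4⟩ : ∃ S : Finset V, H.IsIndepFinset S ∧ S.card = 4 := by
    by_contra hne
    push Not at hne
    have h := hc 4
    rw [coeff_indepPoly, Finset.filter_false_of_mem (fun s _ hs => hne s hs.1 hs.2)] at h
    have h9 : c9 4 = 9 := rfl
    rw [h9] at h
    norm_num at h
  have eS : Fin 4 ≃ {x // x ∈ S} := (Fintype.equivFinOfCardEq (by simpa using hS4)).symm
  have eT : Fin 5 ≃ {x // x ∉ S} := (Fintype.equivFinOfCardEq (by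
    rw [Fintype.card_subtype_compl, hV]; simp [hS4])).symm
  let f : Fin 5 → ℕ := fun t => tm ((Finset.range 4).filter
    (fun i => ∃ h : i < 4, H.Adj (eS ⟨i, h⟩) (eT t)))
  let σ := Tuple.sort f
  have hσ : Monotone (f ∘ σ) := Tuple.monotone_sort f
  let e : Fin 9 ≃ V := (finSumFinEquiv (m := 4) (n := 5)).symm.trans
    ((Equiv.sumCongr eS (σ.trans eT)).trans (Equiv.sumCompl (· ∈ S)))
  have e1 : ∀ (i : ℕ) (h : i < 4) (h' : i < 9), e ⟨i, h'⟩ = eS ⟨i, h⟩ := by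
    intro i h h'
    have : finSumFinEquiv.symm (⟨i, h'⟩ : Fin (4 + 5)) = Sum.inl (⟨i, h⟩ : Fin 4) := by
      rw [Equiv.symm_apply_eq]; rfl
    show Equiv.sumCompl (· ∈ S) (Equiv.sumCongr eS (σ.trans eT)
      (finSumFinEquiv.symm (⟨i, h'⟩ : Fin (4 + 5)))) = _
    rw [this]; rfl
  have e2 : ∀ (i : ℕ) (h : i < 5) (h' : 4 + i < 9), e ⟨4 + i, h'⟩ = eT (σ ⟨i, h⟩) := by
    intro i h h'
    have : finSumFinEquiv.symm (⟨4 + i, h'⟩ : Fin (4 + 5)) = Sum.inr (⟨i, h⟩ : Fin 5) := by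
      rw [Equiv.symm_apply_eq]; rfl
    show Equiv.sumCompl (· ∈ S) (Equiv.sumCongr eS (σ.trans eT)
      (finSumFinEquiv.symm (⟨4 + i, h'⟩ : Fin (4 + 5)))) = _
    rw [this]; rfl
  let G : SimpleGraph (Fin 9) := H.comap e
  have eG : G ≃g H := SimpleGraph.Iso.comap e H
  let r : ℕ → ℕ := fun j => tm ((Finset.range j).filter
    (fun i => ∃ (hi : i < 9) (hj : j < 9), G.Adj ⟨i, hi⟩ ⟨j, hj⟩))
  have hr : ∀ i j : ℕ, (r j).testBit i = true ↔
      i < j ∧ ∃ (hi : i < 9) (hj : j < 9), G.Adj ⟨i, hi⟩ ⟨j, hj⟩ := by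
    intro i j
    show (tm _).testBit i = true ↔ _
    rw [tm_testBit, Finset.mem_filter, Finset.mem_range]
  have hf : ∀ (t : ℕ) (h : t < 5), r (4 + t) % 16 = f (σ ⟨t, h⟩) := by
    intro t h
    apply Nat.eq_of_testBit_eq
    intro i
    rw [Bool.eq_iff_iff, show (16 : ℕ) = 2 ^ 4 from rfl, Nat.testBit_mod_two_pow,
      Bool.and_eq_true, hr]
    show _ ↔ (tm _).testBit i = true
    rw [tm_testBit, Finset.mem_filter, Finset.mem_range, decide_eq_true_iff]
    constructor
    · rintro ⟨hi, _, h1, h2, h3⟩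
      refine ⟨hi, hi, ?_⟩
      have h3 : H.Adj (e _) (e _) := h3
      rwa [e1 i hi, e2 t h] at h3
    · rintro ⟨hi, _, h3⟩
      refine ⟨hi, by omega, by omega, by omega, ?_⟩
      show H.Adj (e _) (e _)
      rwa [e1 i hi, e2 t h]
  obtain ⟨T, hT, ⟨i⟩⟩ := relabel G (fun i j hi hj hadj => by
      have h3 : H.Adj (e ⟨i.1, i.2⟩) (e ⟨j.1, j.2⟩) := hadj
      rw [e1 i hi, e1 j hj] at h3
      exact hS _ (eS _).2 _ (eS _).2 h3) r hr (fun v h4 h8 => by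
      obtain ⟨t, rfl⟩ := Nat.exists_eq_add_of_le h4
      rw [hf t (by omega), show 4 + t + 1 = 4 + (t + 1) from rfl, hf (t + 1) (by omega)]
      exact hσ (Fin.mk_le_mk.2 (Nat.le_succ t))) (fun k => by rw [indepPoly_iso eG, hc])
  exact ⟨T, hT, ⟨i.trans eG⟩⟩

theorem coeff_of {V W : Type} [Fintype V] [Fintype W] {H : SimpleGraph V} {X : SimpleGraph W}
    {T : ℕ} (hT : chkPoly T) (i : Nonempty (X ≃g GT T)) (h : Nonempty (H ≃g X)) (k : ℕ) :
    H.indepPoly.coeff k = (c9 k : ℚ) := by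
  obtain ⟨i⟩ := i
  obtain ⟨h⟩ := h
  rw [indepPoly_iso (h.trans i), coeff_GT T hT]

theorem comb {V W : Type} {H : SimpleGraph V} {X : SimpleGraph W}
    {T : ℕ} (i : Nonempty (X ≃g GT T)) (h : Nonempty (GT T ≃g H)) : Nonempty (H ≃g X) := by
  obtain ⟨i⟩ := i
  obtain ⟨h⟩ := h
  exact ⟨h.symm.trans i.symm⟩

theorem main {V : Type} [Fintype V] (H : SimpleGraph V) :
    H.indepPoly = (cycleGraph 9).indepPoly ↔
      (Nonempty (H ≃g cycleGraph 9) ∨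
       Nonempty (H ≃g Dgraph 9) ∨
       Nonempty (H ≃g cycleGraph 3 ⊕g Agraph 1 2) ∨
       Nonempty (H ≃g cycleGraph 3 ⊕g Egraph 1 2) ∨
       Nonempty (H ≃g cycleGraph 3 ⊕g Egraph 2 1) ∨
       Nonempty (H ≃g cycleGraph 3 ⊕g Bgraph 0 1 1)) := by
  have hC : ∀ k, (cycleGraph 9).indepPoly.coeff k = (c9 k : ℚ) :=
    coeff_of pC isoC ⟨SimpleGraph.Iso.refl⟩
  constructor
  · intro h
    obtain ⟨T, hT, hi⟩ := forward H (fun k => by rw [h, hC])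
    simp only [List.mem_cons, List.not_mem_nil, or_false] at hT
    rcases hT with rfl | rfl | rfl | rfl | rfl | rfl
    · exact Or.inl (comb isoC hi)
    · exact Or.inr (Or.inl (comb isoD hi))
    · exact Or.inr (Or.inr (Or.inl (comb isoA hi)))
    · exact Or.inr (Or.inr (Or.inr (Or.inl (comb isoE12 hi))))
    · exact Or.inr (Or.inr (Or.inr (Or.inr (Or.inl (comb isoE21 hi)))))
    · exact Or.inr (Or.inr (Or.inr (Or.inr (Or.inr (comb isoB hi)))))
  · intro h
    ext k
    rw [hC]
    rcases h with h | h | h | h | h | h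
    · exact coeff_of pC isoC h k
    · exact coeff_of pD isoD h k
    · exact coeff_of pA isoA h k
    · exact coeff_of pE12 isoE12 h k
    · exact coeff_of pE21 isoE21 h k
    · exact coeff_of pB isoB h k

end IC9
/-- The independence equivalence class of `C_9` consists of exactly six graphs:
`C_9`, `D_9`, `C_3 ∪ A_{1,2}`, `C_3 ∪ E_{1,2}`, `C_3 ∪ E_{2,1}` and `C_3 ∪ B_{0,1,1}`. -/
theorem indep_equiv_class_C9 {V : Type} [Fintype V] (H : SimpleGraph V) :
    H.indepPoly = (cycleGraph 9).indepPoly ↔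
      (Nonempty (H ≃g cycleGraph 9) ∨
       Nonempty (H ≃g Dgraph 9) ∨
       Nonempty (H ≃g cycleGraph 3 ⊕g Agraph 1 2) ∨
       Nonempty (H ≃g cycleGraph 3 ⊕g Egraph 1 2) ∨
       Nonempty (H ≃g cycleGraph 3 ⊕g Egraph 2 1) ∨
       Nonempty (H ≃g cycleGraph 3 ⊕g Bgraph 0 1 1)) := by
  exact IC9.main H
end

section
/- A finite simple graph H satisfies I(H,x) = I(C_15,x) if and only if H is isomorphic to one of the following eight graphs: C_15; D_15; the disjoint union C_3 ∪ C_5 ∪ X or C_3 ∪ D_5 ∪ X, where X is one of the three graphs A_{1,3}, E_{1,3}, E_{3,1}. -/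
open Polynomial SimpleGraph

open scoped Classical in
noncomputable def IPol {V : Type*} (G : SimpleGraph V) (S : Finset V) : ℚ[X] :=
  ∑ s ∈ S.powerset, if G.IsIndepFinset s then (X : ℚ[X]) ^ s.card else 0

lemma IPol_univ {V : Type*} [Fintype V] (G : SimpleGraph V) :
    IPol G Finset.univ = G.indepPoly := by
  simp [IPol, SimpleGraph.indepPoly]

lemma IPol_empty {V : Type*} (G : SimpleGraph V) : IPol G ∅ = 1 := by
  simp [IPol, SimpleGraph.IsIndepFinset]

lemma indep_insert {V : Type*} [DecidableEq V] (G : SimpleGraph V) (v : V) (s : Finset V) :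
    G.IsIndepFinset (insert v s) ↔ G.IsIndepFinset s ∧ ∀ w ∈ s, ¬ G.Adj v w := by
  unfold SimpleGraph.IsIndepFinset
  constructor
  · intro h
    exact ⟨fun a ha b hb => h a (by simp [ha]) b (by simp [hb]),
      fun w hw => h v (by simp) w (by simp [hw])⟩
  · rintro ⟨h1, h2⟩ a ha b hb
    simp only [Finset.mem_insert] at ha hb
    rcases ha with rfl | ha <;> rcases hb with rfl | hb
    · simp
    · exact h2 _ hb
    · intro h; exact h2 _ ha h.symm
    · exact h1 _ ha _ hb

open scoped Classical in
lemma IPol_insert {V : Type*} (G : SimpleGraph V) (v : V) (S : Finset V)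
    (hv : v ∉ S) :
    IPol G (insert v S) = IPol G S + X * IPol G (S.filter (fun w => ¬ G.Adj v w)) := by
  unfold IPol
  rw [Finset.sum_powerset_insert hv]
  congr 1
  rw [Finset.mul_sum, ← Finset.sum_subset
    (Finset.powerset_mono.2 (Finset.filter_subset (fun w => ¬ G.Adj v w) S))]
  · apply Finset.sum_congr rfl
    intro t ht
    rw [Finset.mem_powerset] at ht
    have h1 : ∀ w ∈ t, ¬ G.Adj v w := fun w hw => (Finset.mem_filter.1 (ht hw)).2
    have h2 : v ∉ t := fun h => hv (Finset.mem_filter.1 (ht h)).1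
    rw [indep_insert]
    simp only [Finset.card_insert_of_notMem h2]
    by_cases hh : G.IsIndepFinset t
    · rw [if_pos ⟨hh, fun w hw => by simpa using h1 w hw⟩, if_pos hh, pow_succ']
    · rw [if_neg (fun h => hh h.1), if_neg hh, mul_zero]
  · intro t ht ht'
    rw [if_neg]
    rw [indep_insert]
    rintro ⟨_, h⟩
    apply ht'
    rw [Finset.mem_powerset] at ht ⊢
    intro w hw
    exact Finset.mem_filter.2 ⟨ht hw, h w hw⟩

lemma IPol_map {V W : Type*} (G : SimpleGraph V) (H : SimpleGraph W) (f : G ↪g H)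
    (S : Finset V) : IPol H (S.map f.toEmbedding) = IPol G S := by
  classical
  unfold IPol
  have : (S.map f.toEmbedding).powerset = S.powerset.map (Finset.mapEmbedding f.toEmbedding).toEmbedding := by
    ext t
    simp only [Finset.mem_powerset, Finset.mem_map, RelEmbedding.coe_toEmbedding,
      Finset.mapEmbedding_apply]
    constructor
    · intro h
      obtain ⟨u, hu, rfl⟩ := Finset.subset_map_iff.1 h
      exact ⟨u, hu, rfl⟩
    · rintro ⟨u, hu, rfl⟩
      exact Finset.map_subset_map.2 hu
  rw [this, Finset.sum_map]
  apply Finset.sum_congr rfl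
  intro s _
  simp only [RelEmbedding.coe_toEmbedding, Finset.mapEmbedding_apply, Finset.card_map]
  congr 1
  simp [SimpleGraph.IsIndepFinset]

open scoped Classical in
lemma IPol_union {V : Type*} (G : SimpleGraph V) (S T : Finset V)
    (hd : Disjoint S T) (h : ∀ x ∈ S, ∀ y ∈ T, ¬ G.Adj x y) :
    IPol G (S ∪ T) = IPol G S * IPol G T := by
  induction hn : S.card using Nat.strong_induction_on generalizing S with
  | _ n ih =>
    subst hn
    rcases S.eq_empty_or_nonempty with rfl | ⟨v, hv⟩
    · simp [IPol_empty]
    · obtain ⟨S', hvS, rfl⟩ : ∃ S', v ∉ S' ∧ S = insert v S' :=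
        ⟨S.erase v, by simp, (Finset.insert_erase hv).symm⟩
      have hlt : S'.card < (insert v S').card := by simp [hvS]
      have hvT : v ∉ T := Finset.disjoint_left.1 hd hv
      have hd' : Disjoint S' T := hd.mono_left (Finset.subset_insert _ _)
      have hf : (S' ∪ T).filter (fun w => ¬ G.Adj v w) = S'.filter (fun w => ¬ G.Adj v w) ∪ T := by
        rw [Finset.filter_union]
        congr 1
        exact Finset.filter_true_of_mem (fun y hy => h v hv y hy)
      rw [Finset.insert_union, IPol_insert _ _ _ (by simp [hvS, hvT]), IPol_insert _ _ _ hvS, hf,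
        ih S'.card hlt S' hd' (fun x hx => h x (by simp [hx])) rfl,
        ih _ (lt_of_le_of_lt (Finset.card_filter_le _ _) hlt) (S'.filter _)
          (hd'.mono_left (Finset.filter_subset _ _))
          (fun x hx => h x (by simp [(Finset.mem_filter.1 hx).1])) rfl]
      ring

lemma indepPoly_iso {V W : Type*} [Fintype V] [Fintype W] {G : SimpleGraph V} {H : SimpleGraph W}
    (e : G ≃g H) : G.indepPoly = H.indepPoly := by
  rw [← IPol_univ, ← IPol_univ, ← IPol_map G H e.toEmbedding]
  congr 1
  ext x
  simp

lemma indepPoly_sum {V W : Type*} [Fintype V] [Fintype W] (G : SimpleGraph V) (H : SimpleGraph W) :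
    (G ⊕g H).indepPoly = G.indepPoly * H.indepPoly := by
  classical
  rw [← IPol_univ, ← IPol_univ, ← IPol_univ]
  rw [← IPol_map G (G ⊕g H) Embedding.sumInl, ← IPol_map H (G ⊕g H) Embedding.sumInr, ← IPol_union]
  · congr 1
    ext x
    rcases x with x | x
    · simp only [Finset.mem_univ, Finset.mem_union, Finset.mem_map, true_and, true_iff]
      exact Or.inl ⟨x, rfl⟩
    · simp only [Finset.mem_univ, Finset.mem_union, Finset.mem_map, true_and, true_iff]
      exact Or.inr ⟨x, rfl⟩
  · rw [Finset.disjoint_left]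
    intro x hx hy
    simp only [Finset.mem_map, Finset.mem_univ, true_and] at hx hy
    obtain ⟨a, rfl⟩ := hx
    obtain ⟨b, hb⟩ := hy
    simp [Embedding.sumInl, Embedding.sumInr] at hb
  · intro x hx y hy
    simp only [Finset.mem_map, Finset.mem_univ, true_and] at hx hy
    obtain ⟨a, rfl⟩ := hx
    obtain ⟨b, rfl⟩ := hy
    simp [Embedding.sumInl, Embedding.sumInr]

lemma indepPoly_isEmpty {V : Type*} [Fintype V] [IsEmpty V] (G : SimpleGraph V) :
    G.indepPoly = 1 := by
  rw [← IPol_univ, Finset.univ_eq_empty, IPol_empty]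

/-! coefficients -/
lemma IPol_coeff_zero {V : Type*} (G : SimpleGraph V) (S : Finset V) :
    (IPol G S).coeff 0 = 1 := by
  classical
  induction S using Finset.induction_on with
  | empty => simp [IPol_empty]
  | insert v S hv ih => rw [IPol_insert _ _ _ hv]; simp [ih]

lemma IPol_coeff_one {V : Type*} (G : SimpleGraph V) (S : Finset V) :
    (IPol G S).coeff 1 = S.card := by
  classical
  induction S using Finset.induction_on with
  | empty => simp [IPol_empty, Polynomial.coeff_one]
  | insert v S hv ih =>
    rw [IPol_insert _ _ _ hv, Finset.card_insert_of_notMem hv, coeff_add, ih,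
      show (1:ℕ) = 0 + 1 from rfl, coeff_X_mul, IPol_coeff_zero]; simp

lemma indepPoly_coeff_zero {V : Type*} [Fintype V] (G : SimpleGraph V) :
    G.indepPoly.coeff 0 = 1 := by rw [← IPol_univ, IPol_coeff_zero]

lemma indepPoly_coeff_one {V : Type*} [Fintype V] (G : SimpleGraph V) :
    G.indepPoly.coeff 1 = Fintype.card V := by rw [← IPol_univ, IPol_coeff_one]; rfl

/-! codes -/
def adjc : List ℕ → ℕ → ℕ → Bool
  | [], _, _ => false
  | d :: g, i, j => if i = g.length then d.testBit j else adjc g i j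

def addL : List ℕ → List ℕ → List ℕ
  | [], l => l
  | a :: l, [] => a :: l
  | a :: l, b :: l' => (a + b) :: addL l l'

def cntc : List ℕ → ℕ → List ℕ
  | [], _ => [1]
  | d :: g, F => bif F.testBit g.length then cntc g F
      else addL (cntc g F) (0 :: cntc g (F ||| d))

noncomputable def toP : List ℕ → ℚ[X]
  | [] => 0
  | a :: l => C (a : ℚ) + X * toP l

lemma toP_addL (l l' : List ℕ) : toP (addL l l') = toP l + toP l' := by
  induction l generalizing l' with
  | nil => simp [addL, toP]
  | cons a l ih =>
    cases l' with
    | nil => simp [addL, toP]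
    | cons b l' => simp only [addL, toP, ih, Nat.cast_add, C_add]; ring

lemma toP_coeff (l : List ℕ) (k : ℕ) : (toP l).coeff k = ((l.getD k 0 : ℕ) : ℚ) := by
  induction l generalizing k with
  | nil => simp [toP]
  | cons a l ih =>
    cases k with
    | zero => simp [toP]
    | succ k => simp [toP, ih]

def evL : List ℕ → ℕ
  | [] => 0
  | a :: l => a + 1000 * evL l

def force {α : Type} (n : ℕ) (f : ℕ → α) : α :=
  match n with
  | 0 => f 0
  | n + 1 => f (n + 1)

lemma force_eq {α : Type} (n : ℕ) (f : ℕ → α) : force n f = f n := by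
  cases n <;> rfl

def cntN : List ℕ → ℕ → ℕ
  | [], _ => 1
  | d :: g, F => bif Nat.beq ((F.shiftRight g.length).mod 2) 1 then cntN g F
      else (cntN g F).add (Nat.mul 1000 (force (F.lor d) (cntN g)))

lemma evL_addL (l l' : List ℕ) : evL (addL l l') = evL l + evL l' := by
  induction l generalizing l' with
  | nil => simp [addL, evL]
  | cons a l ih =>
    cases l' with
    | nil => simp [addL, evL]
    | cons b l' => simp only [addL, evL, ih]; ring

lemma evL_toP (l : List ℕ) : (toP l).eval 1000 = (evL l : ℚ) := by
  induction l with
  | nil => simp [toP, evL]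
  | cons a l ih => simp [toP, evL, ih]

lemma cntN_eq (g : List ℕ) (F : ℕ) : cntN g F = evL (cntc g F) := by
  induction g generalizing F with
  | nil => simp [cntN, cntc, evL]
  | cons d g ih =>
    have h : Nat.beq ((F.shiftRight g.length).mod 2) 1 = F.testBit g.length := by
      rw [Nat.testBit_eq_decide_div_mod_eq, Bool.eq_iff_iff, Nat.beq_eq]
      simp only [decide_eq_true_eq]
      change (F >>> g.length) % 2 = 1 ↔ _
      rw [Nat.shiftRight_eq_div_pow]
    simp only [cntN, cntc, force_eq, h]
    cases F.testBit g.length with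
    | true => simp [ih]
    | false =>
      simp only [cond_false, ih, evL_addL, evL, Nat.add_eq, Nat.mul_eq, zero_add]
      rfl

lemma cntN_of_toP {g l : List ℕ} (h : toP (cntc g 0) = toP l) : cntN g 0 = evL l := by
  have := congrArg (fun p => p.eval 1000) h
  simp only [evL_toP] at this
  rw [cntN_eq]
  exact_mod_cast this

structure GRep {V : Type*} [Fintype V] (G : SimpleGraph V) (g : List ℕ) (f : V → ℕ) : Prop where
  inj : Function.Injective f
  lt : ∀ x, f x < g.length
  card : Fintype.card V = g.length
  adj : ∀ x y, f y < f x → (G.Adj x y ↔ adjc g (f x) (f y) = true)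

lemma GRep.surj {V : Type*} [Fintype V] {G : SimpleGraph V} {g : List ℕ} {f : V → ℕ}
    (h : GRep G g f) (i : ℕ) (hi : i < g.length) : ∃ x, f x = i := by
  have hb : Function.Bijective (fun x => (⟨f x, h.lt x⟩ : Fin g.length)) := by
    rw [Fintype.bijective_iff_injective_and_card]
    refine ⟨fun a b hab => h.inj (by simpa using hab), by simp [h.card]⟩
  obtain ⟨x, hx⟩ := hb.2 ⟨i, hi⟩
  exact ⟨x, by simpa using hx⟩

lemma GRep.iso {V W : Type*} [Fintype V] [Fintype W] {G : SimpleGraph V} {H : SimpleGraph W}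
    {g : List ℕ} {f : V → ℕ} {f' : W → ℕ} (h : GRep G g f) (h' : GRep H g f') :
    ∃ e : G ≃g H, ∀ x, f' (e x) = f x := by
  choose φ hφ using fun x => h'.surj (f x) (h.lt x)
  have hinj : Function.Injective φ := fun a b hab => h.inj (by rw [← hφ, ← hφ, hab])
  have hb : Function.Bijective φ := by
    rw [Fintype.bijective_iff_injective_and_card]
    exact ⟨hinj, by rw [h.card, h'.card]⟩
  refine ⟨⟨Equiv.ofBijective φ hb, ?_⟩, hφ⟩
  intro a b
  simp only [Equiv.ofBijective_apply]
  rcases lt_trichotomy (f a) (f b) with hlt | heq | hlt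
  · rw [H.adj_comm, G.adj_comm, h.adj _ _ hlt, h'.adj _ _ (by rwa [hφ, hφ]), hφ, hφ]
  · have := h.inj heq
    subst this
    simp
  · rw [h.adj _ _ hlt, h'.adj _ _ (by rwa [hφ, hφ]), hφ, hφ]

lemma IPol_code {V : Type*} [Fintype V] (G : SimpleGraph V) (f : V → ℕ)
    (hinj : Function.Injective f) (g : List ℕ) (F : ℕ)
    (hs : ∀ i < g.length, ∃ x, f x = i)
    (ha : ∀ x y, f x < g.length → f y < f x → (G.Adj x y ↔ adjc g (f x) (f y) = true)) :
    IPol G (Finset.univ.filter (fun x => f x < g.length ∧ F.testBit (f x) = false)) =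
      toP (cntc g F) := by
  classical
  induction g generalizing F with
  | nil => simp [IPol_empty, cntc, toP]
  | cons d g ih =>
    have hs' : ∀ i < g.length, ∃ x, f x = i := fun i hi => hs i (by simp; omega)
    have ha' : ∀ x y, f x < g.length → f y < f x →
        (G.Adj x y ↔ adjc g (f x) (f y) = true) := by
      intro x y hx hy
      rw [ha x y (by simp; omega) hy]
      simp [adjc, hx.ne]
    have ih := fun F => ih F hs' ha'
    obtain ⟨v, hv⟩ := hs g.length (by simp)
    have hv' : ∀ x, f x = g.length ↔ x = v := fun x => ⟨fun h => hinj (h.trans hv.symm), fun h => h ▸ hv⟩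
    simp only [cntc]
    cases hF : F.testBit g.length with
    | true =>
      simp only [cond_true]
      rw [← ih]
      congr 1
      ext x
      simp only [Finset.mem_filter, Finset.mem_univ, true_and, List.length_cons]
      constructor
      · rintro ⟨h1, h2⟩
        refine ⟨?_, h2⟩
        have : f x ≠ g.length := by intro h; rw [h, hF] at h2; simp at h2
        omega
      · rintro ⟨h1, h2⟩
        exact ⟨by omega, h2⟩
    | false =>
      have hset : (Finset.univ.filter (fun x => f x < (d :: g).length ∧ F.testBit (f x) = false)) =
          insert v (Finset.univ.filter (fun x => f x < g.length ∧ F.testBit (f x) = false)) := by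
        ext x
        simp only [Finset.mem_filter, Finset.mem_univ, true_and, List.length_cons, Finset.mem_insert]
        constructor
        · rintro ⟨h1, h2⟩
          rcases Nat.lt_succ_iff_lt_or_eq.1 h1 with h | h
          · exact Or.inr ⟨h, h2⟩
          · exact Or.inl ((hv' x).1 h)
        · rintro (rfl | ⟨h1, h2⟩)
          · rw [hv]; exact ⟨by omega, hF⟩
          · exact ⟨by omega, h2⟩
      rw [hset, IPol_insert _ _ _ (by simp [hv]), cond_false, toP_addL, ih]
      apply congrArg₂ _ rfl
      simp only [toP, Nat.cast_zero, C_0, zero_add]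
      rw [← ih]
      apply congrArg (fun S => X * IPol G S)
      ext x
      simp only [Finset.mem_filter, Finset.mem_univ, true_and, Nat.testBit_or, Bool.or_eq_false_iff]
      constructor
      · rintro ⟨⟨h1, h2⟩, h3⟩
        refine ⟨h1, h2, ?_⟩
        rw [ha v x (by rw [hv]; simp) (by rw [hv]; exact h1), hv] at h3
        simpa [adjc] using h3
      · rintro ⟨h1, h2, h3⟩
        refine ⟨⟨h1, h2⟩, ?_⟩
        rw [ha v x (by rw [hv]; simp) (by rw [hv]; exact h1), hv]
        simpa [adjc] using h3

lemma GRep.poly {V : Type*} [Fintype V] {G : SimpleGraph V} {g : List ℕ} {f : V → ℕ}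
    (h : GRep G g f) : G.indepPoly = toP (cntc g 0) := by
  rw [← IPol_code G f h.inj g 0 h.surj (fun x y _ hy => h.adj x y hy), ← IPol_univ]
  congr 1
  ext x
  simp [h.lt]

instance (n : ℕ) : DecidableRel (Dgraph n).Adj := by unfold Dgraph; infer_instance
instance (m n : ℕ) : DecidableRel (Agraph m n).Adj := by unfold Agraph; infer_instance
instance (m n : ℕ) : DecidableRel (Egraph m n).Adj := by unfold Egraph; infer_instance

def pathC : ℕ → List ℕ
  | 0 => []
  | n + 1 => (if n = 0 then 0 else 2 ^ (n - 1)) :: pathC n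

def cycC (k : ℕ) : List ℕ := match k with
  | 0 => []
  | n + 1 => (1 ||| 2 ^ (n - 1)) :: pathC n

def code1 (k : ℕ) : ℕ → List ℕ
  | 0 => cycC k
  | m + 1 => 2 ^ (if m = 0 then 0 else k + m - 1) :: code1 k m

def code2 (k m q : ℕ) : ℕ → List ℕ
  | 0 => code1 k m
  | l + 1 => 2 ^ (if l = 0 then q else k + m + l - 1) :: code2 k m q l

lemma repOf {n : ℕ} (G : SimpleGraph (Fin n)) [DecidableRel G.Adj] (g : List ℕ) (p : List ℕ)
    (h : (g.length = n ∧ (∀ i : Fin n, p.getD i 0 < n) ∧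
      ∀ i j : Fin n, (p.getD i 0 = p.getD j 0 → i = j) ∧
       (p.getD j 0 < p.getD i 0 → (decide (G.Adj i j) = adjc g (p.getD i 0) (p.getD j 0))))) :
    GRep G g (fun i => p.getD i 0) := by
  obtain ⟨h1, h2, h3⟩ := h
  refine ⟨fun i j hij => (h3 i j).1 hij, fun i => by rw [h1]; exact h2 i, by simp [h1], ?_⟩
  intro i j hij
  rw [← (h3 i j).2 hij]
  simp

lemma rep_C15 : GRep (cycleGraph 15) (code1 15 0) (fun i => (List.range 15).getD i 0) :=
  repOf _ _ _ (by decide +kernel)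
lemma rep_D15 : GRep (Dgraph 15) (code1 3 12) (fun i => ([1,2,0,3,4,5,6,7,8,9,10,11,12,13,14]).getD i 0) :=
  repOf _ _ _ (by decide +kernel)
lemma rep_C3 : GRep (cycleGraph 3) (code1 3 0) (fun i => (List.range 3).getD i 0) :=
  repOf _ _ _ (by decide +kernel)
lemma rep_C5 : GRep (cycleGraph 5) (code1 5 0) (fun i => (List.range 5).getD i 0) :=
  repOf _ _ _ (by decide +kernel)
lemma rep_D5 : GRep (Dgraph 5) (code1 3 2) (fun i => ([1,2,0,3,4]).getD i 0) :=
  repOf _ _ _ (by decide +kernel)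
lemma rep_E13 : GRep (Egraph 1 3) (code1 4 3) (fun i => ([0,1,2,3,4,5,6]).getD i 0) :=
  repOf _ _ _ (by decide +kernel)
lemma rep_E13' : GRep (Egraph 1 3) (code2 4 1 4 2) (fun i => ([0,1,2,3,4,5,6]).getD i 0) :=
  repOf _ _ _ (by decide +kernel)
lemma rep_E13'' : GRep (Egraph 1 3) (code2 4 2 5 1) (fun i => ([0,1,2,3,4,5,6]).getD i 0) :=
  repOf _ _ _ (by decide +kernel)
lemma rep_E31 : GRep (Egraph 3 1) (code1 6 1) (fun i => ([0,1,2,3,4,5,6]).getD i 0) :=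
  repOf _ _ _ (by decide +kernel)
lemma rep_A1 : GRep (Agraph 1 3) (code2 3 1 1 3) (fun i => ([3,0,1,4,5,6,2]).getD i 0) :=
  repOf _ _ _ (by decide +kernel)
lemma rep_A2 : GRep (Agraph 1 3) (code2 3 1 2 3) (fun i => ([3,0,2,4,5,6,1]).getD i 0) :=
  repOf _ _ _ (by decide +kernel)
lemma rep_A3 : GRep (Agraph 1 3) (code2 3 3 1 1) (fun i => ([6,1,0,3,4,5,2]).getD i 0) :=
  repOf _ _ _ (by decide +kernel)
lemma rep_A4 : GRep (Agraph 1 3) (code2 3 3 2 1) (fun i => ([6,2,0,3,4,5,1]).getD i 0) :=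
  repOf _ _ _ (by decide +kernel)


lemma cycle_i3 : ∀ k ∈ List.range 16, 3 ≤ k →
   (k : ℤ) * ((k : ℤ) - 4) * ((k : ℤ) - 5) ≤ 6 * (((cntc (cycC k) 0).getD 3 0 : ℕ) + 1) := by decide +kernel


/-! degrees and leaves -/
open scoped Classical in
noncomputable def dg {V : Type} [Fintype V] (G : SimpleGraph V) (x : V) : ℕ :=
  ∑ y, if G.Adj x y then 1 else 0

open scoped Classical in
noncomputable def nl {V : Type} [Fintype V] (G : SimpleGraph V) : ℕ :=
  ∑ x, if dg G x = 1 then 1 else 0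

abbrev delv {V : Type} (G : SimpleGraph V) (v : V) : SimpleGraph {x // x ≠ v} :=
  G.comap Subtype.val

lemma dg_eq {V : Type} [Fintype V] (G : SimpleGraph V) (x : V) [Fintype (G.neighborSet x)] :
    dg G x = G.degree x := by
  classical
  unfold dg
  rw [Finset.sum_boole, Nat.cast_id, ← G.card_neighborSet_eq_degree, Fintype.card_subtype]
  congr 1

lemma leaf_nbr {V : Type} [Fintype V] (G : SimpleGraph V) (v : V) (h : dg G v = 1) :
    ∃ w, ∀ x, G.Adj v x ↔ x = w := by
  classical
  rw [dg_eq, degree_eq_one_iff_existsUnique_adj] at h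
  obtain ⟨w, hw, hu⟩ := h
  exact ⟨w, fun x => ⟨fun hx => hu x hx, fun hx => hx ▸ hw⟩⟩

lemma conn_dg_pos {V : Type} [Fintype V] (G : SimpleGraph V) (h : G.Connected)
    (hc : 2 ≤ Fintype.card V) (x : V) : 1 ≤ dg G x := by
  classical
  have : Nontrivial V := Fintype.one_lt_card_iff_nontrivial.1 hc
  rw [dg_eq]
  exact h.preconnected.degree_pos_of_nontrivial x

lemma dg_lt {V : Type} [Fintype V] (G : SimpleGraph V) (x : V) : dg G x < Fintype.card V := by
  classical
  rw [dg_eq]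
  exact G.degree_lt_card_verts x

section leafdel
open scoped Classical

lemma sum_del {V : Type} [Fintype V] (v : V) (f : V → ℕ) :
    ∑ x, f x = f v + ∑ x : {x // x ≠ v}, f x := by
  rw [Fintype.sum_eq_add_sum_subtype_ne f v]

lemma card_del {V : Type} [Fintype V] (v : V) :
    Fintype.card V = Fintype.card {x // x ≠ v} + 1 := by
  have := sum_del v (fun _ => 1)
  simp only [Finset.sum_const, smul_eq_mul, mul_one, Finset.card_univ] at this
  omega

lemma dg_del {V : Type} [Fintype V] (G : SimpleGraph V) (v w : V)
    (hN : ∀ x, G.Adj v x ↔ x = w) (x : {x // x ≠ v}) :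
    dg G x = dg (delv G v) x + if (x : V) = w then 1 else 0 := by
  unfold dg
  rw [sum_del v]
  rw [add_comm]
  congr 1
  simp only [G.adj_comm x v, hN]

lemma sum_dg_del {V : Type} [Fintype V] (G : SimpleGraph V) (v w : V)
    (hN : ∀ x, G.Adj v x ↔ x = w) : ∑ x, dg G x = ∑ x, dg (delv G v) x + 2 := by
  have hvw : w ≠ v := by rintro rfl; exact G.loopless.irrefl _ ((hN w).2 rfl)
  have hv : dg G v = 1 := by unfold dg; simp [hN]
  rw [sum_del v, hv]
  simp_rw [dg_del G v w hN]
  rw [Finset.sum_add_distrib]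
  have : ∑ x : {x // x ≠ v}, (if (x : V) = w then 1 else 0) = 1 := by
    rw [Finset.sum_eq_single ⟨w, hvw⟩]
    · simp
    · intro b _ hb
      rw [if_neg]
      intro h; exact hb (Subtype.ext h)
    · simp
  omega

lemma nl_del {V : Type} [Fintype V] (G : SimpleGraph V) (v w : V)
    (hN : ∀ x, G.Adj v x ↔ x = w) (hw : 2 ≤ dg G w) :
    nl G + (if dg G w = 2 then 1 else 0) = nl (delv G v) + 1 := by
  have hvw : w ≠ v := by rintro rfl; exact G.loopless.irrefl _ ((hN w).2 rfl)
  have hv : dg G v = 1 := by unfold dg; simp [hN]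
  unfold nl
  rw [sum_del v, hv, if_pos rfl]
  have : ∀ x : {x // x ≠ v}, (if dg (delv G v) x = 1 then 1 else 0) =
      (if dg G x = 1 then 1 else 0) + (if (x : V) = w then (if dg G w = 2 then 1 else 0) else 0) := by
    intro x
    have h := dg_del G v w hN x
    by_cases hx : (x : V) = w
    · rw [if_pos hx] at h
      have hx' : dg G x = dg G w := by rw [hx]
      rw [if_pos hx]
      split_ifs <;> omega
    · rw [if_neg hx] at h
      rw [if_neg hx, h]
      simp
  rw [Finset.sum_congr rfl (fun x _ => this x), Finset.sum_add_distrib]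
  have : ∑ x : {x // x ≠ v}, (if (x : V) = w then (if dg G w = 2 then 1 else 0) else 0) =
      (if dg G w = 2 then 1 else 0) := by
    rw [Finset.sum_eq_single ⟨w, hvw⟩]
    · simp
    · intro b _ hb
      rw [if_neg]
      intro h; exact hb (Subtype.ext h)
    · simp
  omega

lemma conn_del {V : Type} [Fintype V] (G : SimpleGraph V) (v : V) (h : G.Connected)
    (hv : dg G v = 1) : (delv G v).Connected := by
  rw [dg_eq] at hv
  exact h.induce_compl_singleton_of_degree_eq_one hv

lemma GRep.ext {V : Type} [Fintype V] (G : SimpleGraph V) (v w : V)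
    (hN : ∀ x, G.Adj v x ↔ x = w) (hvw : w ≠ v) (g : List ℕ) (f : {x // x ≠ v} → ℕ)
    (h : GRep (delv G v) g f) :
    ∃ f' : V → ℕ, GRep G (2 ^ (f ⟨w, hvw⟩) :: g) f' ∧ f' v = g.length ∧ ∀ x, f' x.1 = f x := by
  refine ⟨fun x => if hx : x = v then g.length else f ⟨x, hx⟩, ⟨?_, ?_, ?_, ?_⟩, ?_, ?_⟩
  · intro a b hab
    by_cases ha : a = v <;> by_cases hb : b = v
    · rw [ha, hb]
    · have := h.lt ⟨b, hb⟩
      simp [ha, hb] at hab; omega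
    · have := h.lt ⟨a, ha⟩
      simp [ha, hb] at hab; omega
    · simp only [ha, hb, dif_neg, not_false_eq_true] at hab
      have := h.inj hab
      simpa using this
  · intro x
    by_cases hx : x = v
    · simp [hx]
    · have := h.lt ⟨x, hx⟩
      simp [hx]; omega
  · rw [card_del v, List.length_cons, ← h.card]
  · intro x y hxy
    by_cases hx : x = v <;> by_cases hy : y = v
    · simp [hx, hy] at hxy
    · subst hx
      simp only [adjc, dif_pos, if_true, dif_neg hy, hN, Nat.testBit_two_pow, decide_eq_true_eq]
      constructor
      · intro hh; subst hh; rfl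
      · intro hh
        have := h.inj hh
        simpa using this.symm
    · have := h.lt ⟨x, hx⟩
      simp [hx, hy] at hxy; omega
    · simp only [hx, hy, dif_neg, not_false_eq_true] at hxy ⊢
      have h1 := h.adj ⟨x, hx⟩ ⟨y, hy⟩ hxy
      have h2 := h.lt ⟨x, hx⟩
      simp only [adjc, h2.ne, if_false]
      rw [← h1]
      simp
  · simp
  · intro x
    simp [x.2]

end leafdel

lemma pathC_length (n : ℕ) : (pathC n).length = n := by
  induction n with
  | zero => rfl
  | succ n ih => simp [pathC, ih]

lemma cycC_length (n : ℕ) : (cycC n).length = n := by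
  cases n with
  | zero => rfl
  | succ n => simp [cycC, pathC_length]

lemma code1_length (k m : ℕ) : (code1 k m).length = k + m := by
  induction m with
  | zero => simp [code1, cycC_length]
  | succ n ih => simp [code1, ih]; omega

lemma code2_length (k m q l : ℕ) : (code2 k m q l).length = k + m + l := by
  induction l with
  | zero => simp [code2, code1_length]
  | succ n ih => simp [code2, ih]; omega

lemma adjc_path (n i j : ℕ) (hj : j < i) (hi : i < n) :
    adjc (pathC n) i j = true ↔ i = j + 1 := by
  induction n with
  | zero => omega
  | succ n ih =>
    simp only [pathC, adjc, pathC_length]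
    by_cases h : i = n
    · rw [if_pos h, if_neg (by omega), Nat.testBit_two_pow]
      simp only [decide_eq_true_eq]; omega
    · rw [if_neg h]; exact ih (by omega)

lemma adjc_cyc (n i j : ℕ) (hj : j < i) (hi : i < n) :
    adjc (cycC n) i j = true ↔ (i = j + 1 ∨ (i + 1 = n ∧ j = 0)) := by
  cases n with
  | zero => omega
  | succ n =>
    simp only [cycC, adjc, pathC_length]
    by_cases h : i = n
    · rw [if_pos h, Nat.testBit_or, Nat.testBit_two_pow, show (1:ℕ) = 2 ^ 0 from rfl,
        Nat.testBit_two_pow]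
      simp only [Bool.or_eq_true, decide_eq_true_eq]; omega
    · rw [if_neg h, adjc_path n i j hj (by omega)]; omega

lemma path_rep (n : ℕ) : ∀ (V : Type) [Fintype V] (G : SimpleGraph V) (v : V),
    Fintype.card V = n → G.Connected → (∀ x, dg G x ≤ 2) → dg G v ≤ 1 →
    ∃ f, GRep G (pathC n) f ∧ f v + 1 = n := by
  classical
  induction n with
  | zero =>
    intro V _ G v hc
    have := Fintype.card_pos_iff.2 ⟨v⟩
    omega
  | succ n ih =>
    intro V _ G v hc hG h2 h1
    by_cases hn : n = 0
    · subst hn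
      have hs : ∀ x y : V, x = y := fun x y => by
        have := Fintype.card_le_one_iff.1 hc.le
        exact this x y
      refine ⟨fun _ => 0, ⟨fun x y _ => hs x y, fun x => by simp [pathC], by simp [pathC, hc], ?_⟩, rfl⟩
      intro x y h; simp at h
    · have h1' : dg G v = 1 := le_antisymm h1 (conn_dg_pos G hG (by omega) v)
      obtain ⟨w, hN⟩ := leaf_nbr G v h1'
      have hvw : w ≠ v := by rintro rfl; exact G.loopless.irrefl _ ((hN w).2 rfl)
      have hdw := dg_del G v w hN
      have hcd := card_del (V := V) v
      obtain ⟨f, hf, hfw⟩ := ih {x // x ≠ v} (delv G v) ⟨w, hvw⟩ (by omega) (conn_del G v hG h1')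
        (fun x => by have := hdw x; have := h2 x; omega)
        (by have := hdw ⟨w, hvw⟩; have := h2 w; simp at *; omega)
      obtain ⟨f', hf', hv', -⟩ := hf.ext G v w hN hvw
      refine ⟨f', ?_, by rw [hv', pathC_length]⟩
      have : f ⟨w, hvw⟩ = n - 1 := by omega
      rw [this] at hf'
      simpa [pathC, hn] using hf'

/-! cycles -/
lemma cyc_base (V : Type) [Fintype V] (G : SimpleGraph V) (hG : G.Connected)
    (h2 : ∀ x, dg G x = 2) (hn : 3 ≤ Fintype.card V) :
    ∃ f, GRep G (cycC (Fintype.card V)) f := by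
  classical
  have hna : ¬ G.IsAcyclic := by
    intro ha
    have ht : G.IsTree := ⟨hG, ha⟩
    have h1 := ht.card_edgeFinset
    have h3 := G.sum_degrees_eq_twice_card_edges
    simp only [← dg_eq, h2, Finset.sum_const, Finset.card_univ, smul_eq_mul] at h3
    omega
  rw [isAcyclic_iff_forall_adj_isBridge] at hna
  push Not at hna
  obtain ⟨u, v, huv, hb⟩ := hna
  have hc := hG.connected_delete_edge_of_not_isBridge hb
  set G₁ := G.deleteEdges {s(u, v)} with hG₁
  have hadj : ∀ x y, G₁.Adj x y ↔ G.Adj x y ∧ ¬ ((x = u ∧ y = v) ∨ (x = v ∧ y = u)) := by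
    intro x y
    simp [hG₁, deleteEdges_adj]
  have hle : ∀ x, dg G₁ x ≤ 2 := by
    intro x
    rw [← h2 x]
    apply Finset.sum_le_sum
    intro y _
    have := hadj x y
    split_ifs <;> simp_all
  have hu : dg G₁ u + 1 ≤ 2 := by
    rw [← h2 u]
    unfold dg
    apply Nat.succ_le_of_lt
    apply Finset.sum_lt_sum
    · intro y _
      have := hadj u y
      split_ifs <;> simp_all
    · refine ⟨v, by simp, ?_⟩
      have := hadj u v
      simp_all
  have hv : dg G₁ v + 1 ≤ 2 := by
    rw [← h2 v]
    unfold dg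
    apply Nat.succ_le_of_lt
    apply Finset.sum_lt_sum
    · intro y _
      have := hadj v y
      split_ifs <;> simp_all
    · refine ⟨u, by simp, ?_⟩
      have := hadj v u
      simp_all [G.adj_comm v u]
  obtain ⟨f, hf, hfu⟩ := path_rep _ V G₁ u rfl hc hle (by omega)
  have hl := hf.lt
  rw [pathC_length] at hl
  have huvne : u ≠ v := huv.ne
  have hfv : f v = 0 := by
    by_contra h0
    have hne : f v ≠ f u := fun h => huvne (hf.inj h.symm)
    have hlv := hl v
    obtain ⟨a, ha⟩ := hf.surj (f v - 1) (by rw [pathC_length]; omega)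
    obtain ⟨b, hb⟩ := hf.surj (f v + 1) (by rw [pathC_length]; omega)
    have h1 : G₁.Adj v a := by
      rw [hf.adj v a (by omega), adjc_path _ _ _ (by omega) (hl v)]; omega
    have h2 : G₁.Adj v b := by
      rw [G₁.adj_comm, hf.adj b v (by omega), adjc_path _ _ _ (by omega) (hl b)]; omega
    obtain ⟨w, hw⟩ := leaf_nbr G₁ v (le_antisymm (by omega) (conn_dg_pos G₁ hc (by omega) v))
    rw [(hw a).1 h1] at ha
    rw [(hw b).1 h2] at hb
    omega
  refine ⟨f, hf.inj, by rw [cycC_length]; exact hl, by rw [cycC_length], ?_⟩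
  intro x y hxy
  rw [adjc_cyc _ _ _ hxy (hl x)]
  have h1 := hf.adj x y hxy
  rw [adjc_path _ _ _ hxy (hl x), hadj] at h1
  constructor
  · intro h
    by_cases hc : ((x = u ∧ y = v) ∨ (x = v ∧ y = u))
    · rcases hc with ⟨rfl, rfl⟩ | ⟨rfl, rfl⟩
      · right; omega
      · omega
    · left; exact h1.1 ⟨h, hc⟩
  · rintro (h | ⟨h, h'⟩)
    · exact (h1.2 h).1
    · have hx : x = u := hf.inj (by omega)
      have hy : y = v := hf.inj (by omega)
      rw [hx, hy]; exact huv

lemma cyc_rep (V : Type) [Fintype V] (G : SimpleGraph V) (hG : G.Connected)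
    (h2 : ∀ x, dg G x = 2) (hn : 3 ≤ Fintype.card V) (w : V) :
    ∃ f, GRep G (cycC (Fintype.card V)) f ∧ f w = 0 := by
  obtain ⟨f, hf⟩ := cyc_base V G hG h2 hn
  have hl := hf.lt
  rw [cycC_length] at hl
  have hlw := hl w
  have key : ∀ x y, G.Adj x y ↔ (f x = f y + 1 ∨ f y = f x + 1 ∨
      (f x + 1 = Fintype.card V ∧ f y = 0) ∨ (f y + 1 = Fintype.card V ∧ f x = 0)) := by
    intro x y
    have hx := hl x
    have hy := hl y
    rcases lt_trichotomy (f y) (f x) with h | h | h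
    · rw [hf.adj _ _ h, adjc_cyc _ _ _ h hx]; omega
    · have := hf.inj h; subst this; simp; omega
    · rw [G.adj_comm, hf.adj _ _ h, adjc_cyc _ _ _ h hy]; omega
  refine ⟨fun x => if f w ≤ f x then f x - f w else f x + Fintype.card V - f w,
    ⟨?_, ?_, by rw [cycC_length], ?_⟩, by simp⟩
  · intro x y h
    apply hf.inj
    have hx := hl x
    have hy := hl y
    simp only at h
    split_ifs at h <;> omega
  · intro x
    have hx := hl x
    rw [cycC_length]
    split_ifs <;> omega
  · intro x y hxy
    have hx := hl x
    have hy := hl y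
    rw [adjc_cyc _ _ _ hxy (by split_ifs <;> omega), key]
    split_ifs at * <;> omega

/-! classification of connected unicyclic graphs with few leaves -/
lemma uni_card {V : Type} [Fintype V] (G : SimpleGraph V) (hG : G.Connected)
    (hs : ∑ x, dg G x = 2 * Fintype.card V) : 3 ≤ Fintype.card V := by
  have h0 : 1 ≤ Fintype.card V := Fintype.card_pos_iff.2 hG.nonempty
  have h1 : ∑ x, dg G x ≤ ∑ _x : V, (Fintype.card V - 1) :=
    Finset.sum_le_sum fun x _ => by have := dg_lt G x; omega
  simp only [Finset.sum_const, Finset.card_univ, smul_eq_mul] at h1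
  rw [hs] at h1
  by_contra h
  interval_cases Fintype.card V <;> omega

lemma uni_all2 {V : Type} [Fintype V] (G : SimpleGraph V) (hG : G.Connected)
    (hs : ∑ x, dg G x = 2 * Fintype.card V) (hl : nl G = 0) (x : V) : dg G x = 2 := by
  classical
  have h3 := uni_card G hG hs
  have h2 : ∀ x, 2 ≤ dg G x := by
    intro x
    have h := conn_dg_pos G hG (by omega) x
    have h' := (Finset.sum_eq_zero_iff.1 hl) x (Finset.mem_univ x)
    have : dg G x ≠ 1 := by intro h; simp [h] at h'
    omega
  have h4 : ∑ _x : V, 2 = ∑ x, dg G x := by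
    rw [hs]; simp [mul_comm]
  exact ((Finset.sum_eq_sum_iff_of_le (fun x _ => h2 x)).1 h4 x (Finset.mem_univ x)).symm

lemma nl_pos {V : Type} [Fintype V] (G : SimpleGraph V) (h : nl G ≠ 0) : ∃ v, dg G v = 1 := by
  classical
  by_contra hh
  push Not at hh
  exact h (Finset.sum_eq_zero fun x _ => if_neg (hh x))

open scoped Classical in
lemma leaf_setup {V : Type} [Fintype V] (G : SimpleGraph V) (hG : G.Connected)
    (hs : ∑ x, dg G x = 2 * Fintype.card V) (v : V) (hv : dg G v = 1) :
    ∃ w, ∃ hvw : w ≠ v, (∀ x, G.Adj v x ↔ x = w) ∧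
      Fintype.card V = Fintype.card {x // x ≠ v} + 1 ∧
      (delv G v).Connected ∧
      ∑ x, dg (delv G v) x = 2 * Fintype.card {x // x ≠ v} ∧
      2 ≤ dg G w ∧ dg G w = dg (delv G v) ⟨w, hvw⟩ + 1 ∧
      nl G + (if dg G w = 2 then 1 else 0) = nl (delv G v) + 1 := by
  obtain ⟨w, hN⟩ := leaf_nbr G v hv
  have hvw : w ≠ v := by rintro rfl; exact G.loopless.irrefl _ ((hN w).2 rfl)
  have hcd := card_del (V := V) v
  have hcon := conn_del G v hG hv
  have hsd := sum_dg_del G v w hN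
  have h3 := uni_card G hG hs
  have hw : dg G w = dg (delv G v) ⟨w, hvw⟩ + 1 := by
    have := dg_del G v w hN ⟨w, hvw⟩
    simpa using this
  have hw2 : 2 ≤ dg G w := by
    have := conn_dg_pos _ hcon (by omega) ⟨w, hvw⟩
    omega
  exact ⟨w, hvw, hN, hcd, hcon, by omega, hw2, hw, nl_del G v w hN hw2⟩

lemma P1 (n : ℕ) : ∀ (V : Type) [Fintype V] (G : SimpleGraph V) (v : V),
    Fintype.card V = n → G.Connected → ∑ x, dg G x = 2 * Fintype.card V → nl G ≤ 1 →
    dg G v = 1 →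
    ∃ k m f, 3 ≤ k ∧ 1 ≤ m ∧ k + m = n ∧ GRep G (code1 k m) f ∧ f v + 1 = n := by
  classical
  induction n with
  | zero =>
    intro V _ G v hc
    have := Fintype.card_pos_iff.2 ⟨v⟩
    omega
  | succ n ih =>
    intro V _ G v hc hG hs hl hv
    obtain ⟨w, hvw, hN, hcd, hcon, hs', hw2, hw, hnl⟩ := leaf_setup G hG hs v hv
    by_cases h2 : dg G w = 2
    · rw [if_pos h2] at hnl
      obtain ⟨k, m, f, hk, hm, hkm, hf, hfw⟩ := ih _ (delv G v) ⟨w, hvw⟩ (by omega) hcon hs'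
        (by omega) (by omega)
      obtain ⟨f', hf', hv', -⟩ := hf.ext G v w hN hvw
      refine ⟨k, m + 1, f', hk, by omega, by omega, ?_, by rw [hv', code1_length]; omega⟩
      have : f ⟨w, hvw⟩ = k + m - 1 := by omega
      rw [this] at hf'
      simpa [code1, show m ≠ 0 by omega] using hf'
    · rw [if_neg h2] at hnl
      have h3 := uni_card _ hcon hs'
      obtain ⟨f, hf, hfw⟩ := cyc_rep _ (delv G v) hcon (uni_all2 _ hcon hs' (by omega)) h3 ⟨w, hvw⟩
      obtain ⟨f', hf', hv', -⟩ := hf.ext G v w hN hvw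
      refine ⟨_, 1, f', h3, le_rfl, by omega, ?_, by rw [hv', cycC_length]; omega⟩
      rw [hfw] at hf'
      simpa [code1] using hf'

lemma P2 (n : ℕ) : ∀ (V : Type) [Fintype V] (G : SimpleGraph V) (v : V),
    Fintype.card V = n → G.Connected → ∑ x, dg G x = 2 * Fintype.card V → nl G = 2 →
    dg G v = 1 →
    ∃ k m q l f, 3 ≤ k ∧ 1 ≤ m ∧ 1 ≤ l ∧ q < k + m ∧ k + m + l = n ∧
      GRep G (code2 k m q l) f ∧ f v + 1 = n := by
  classical
  induction n with
  | zero =>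
    intro V _ G v hc
    have := Fintype.card_pos_iff.2 ⟨v⟩
    omega
  | succ n ih =>
    intro V _ G v hc hG hs hl hv
    obtain ⟨w, hvw, hN, hcd, hcon, hs', hw2, hw, hnl⟩ := leaf_setup G hG hs v hv
    by_cases h2 : dg G w = 2
    · rw [if_pos h2] at hnl
      obtain ⟨k, m, q, l, f, hk, hm, hl1, hq, hkm, hf, hfw⟩ := ih _ (delv G v) ⟨w, hvw⟩
        (by omega) hcon hs' (by omega) (by omega)
      obtain ⟨f', hf', hv', -⟩ := hf.ext G v w hN hvw
      refine ⟨k, m, q, l + 1, f', hk, hm, by omega, hq, by omega, ?_,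
        by rw [hv', code2_length]; omega⟩
      have : f ⟨w, hvw⟩ = k + m + l - 1 := by omega
      rw [this] at hf'
      simpa [code2, show l ≠ 0 by omega] using hf'
    · rw [if_neg h2] at hnl
      obtain ⟨u, hu⟩ := nl_pos (delv G v) (by omega)
      obtain ⟨k, m, f, hk, hm, hkm, hf, -⟩ := P1 n _ (delv G v) u (by omega) hcon hs' (by omega) hu
      obtain ⟨f', hf', hv', -⟩ := hf.ext G v w hN hvw
      have hlt := hf.lt ⟨w, hvw⟩
      rw [code1_length] at hlt
      refine ⟨k, m, f ⟨w, hvw⟩, 1, f', hk, hm, le_rfl, hlt, by omega, ?_,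
        by rw [hv', code1_length]; omega⟩
      simpa [code2] using hf'

lemma class0 {V : Type} [Fintype V] (G : SimpleGraph V) (hG : G.Connected)
    (hs : ∑ x, dg G x = 2 * Fintype.card V) (hl : nl G = 0) :
    ∃ f, GRep G (code1 (Fintype.card V) 0) f := by
  obtain ⟨v⟩ := hG.nonempty
  obtain ⟨f, hf, -⟩ := cyc_rep V G hG (uni_all2 G hG hs hl) (uni_card G hG hs) v
  exact ⟨f, hf⟩

lemma class1 {V : Type} [Fintype V] (G : SimpleGraph V) (hG : G.Connected)
    (hs : ∑ x, dg G x = 2 * Fintype.card V) (hl : nl G ≤ 1) :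
    ∃ k m f, 3 ≤ k ∧ k + m = Fintype.card V ∧ GRep G (code1 k m) f := by
  by_cases h : nl G = 0
  · obtain ⟨f, hf⟩ := class0 G hG hs h
    exact ⟨_, 0, f, uni_card G hG hs, rfl, hf⟩
  · obtain ⟨v, hv⟩ := nl_pos G h
    obtain ⟨k, m, f, h1, -, h2, h3, -⟩ := P1 _ V G v rfl hG hs hl hv
    exact ⟨k, m, f, h1, h2, h3⟩

lemma class2 {V : Type} [Fintype V] (G : SimpleGraph V) (hG : G.Connected)
    (hs : ∑ x, dg G x = 2 * Fintype.card V) (hl : nl G ≤ 2) :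
    (∃ k m f, 3 ≤ k ∧ k + m = Fintype.card V ∧ GRep G (code1 k m) f) ∨
    ∃ k m q l f, 3 ≤ k ∧ 1 ≤ m ∧ 1 ≤ l ∧ q < k + m ∧ k + m + l = Fintype.card V ∧
      GRep G (code2 k m q l) f := by
  by_cases h : nl G ≤ 1
  · exact Or.inl (class1 G hG hs h)
  · obtain ⟨v, hv⟩ := nl_pos G (by omega)
    obtain ⟨k, m, q, l, f, h1, h2, h3, h4, h5, h6, -⟩ := P2 _ V G v rfl hG hs (by omega) hv
    exact Or.inr ⟨k, m, q, l, f, h1, h2, h3, h4, h5, h6⟩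

/-! coefficients two and three -/
section cf
open scoped Classical

lemma IPol_coeff_two {V : Type} (G : SimpleGraph V) (S : Finset V) :
    2 * (IPol G S).coeff 2 + ((∑ x ∈ S, ∑ y ∈ S, if G.Adj x y then 1 else 0 : ℕ) : ℚ) =
      S.card * (S.card - 1) := by
  induction S using Finset.induction_on with
  | empty => simp [IPol_empty, Polynomial.coeff_one]
  | insert v S hv ih =>
    rw [IPol_insert _ _ _ hv, Finset.card_insert_of_notMem hv, coeff_add,
      show (2 : ℕ) = 1 + 1 from rfl, coeff_X_mul, IPol_coeff_one]
    have h1 : ((S.filter (fun w => ¬ G.Adj v w)).card : ℚ) =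
        S.card - ((∑ y ∈ S, if G.Adj v y then 1 else 0 : ℕ) : ℚ) := by
      have := Finset.card_filter_add_card_filter_not (s := S) (fun w => G.Adj v w)
      rw [Finset.sum_boole, ← this]
      push_cast
      ring
    have h2 : (∑ x ∈ insert v S, ∑ y ∈ insert v S, if G.Adj x y then 1 else 0 : ℕ) =
        (∑ x ∈ S, ∑ y ∈ S, if G.Adj x y then 1 else 0 : ℕ) +
        2 * (∑ y ∈ S, if G.Adj v y then 1 else 0 : ℕ) := by
      simp only [Finset.sum_insert hv, Finset.sum_add_distrib, G.adj_comm _ v]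
      simp
      ring
    rw [h1, h2]
    push_cast at ih ⊢
    linarith

lemma coeff_two {V : Type} [Fintype V] (G : SimpleGraph V) :
    2 * G.indepPoly.coeff 2 + ((∑ x, dg G x : ℕ) : ℚ) =
      (Fintype.card V) * ((Fintype.card V : ℚ) - 1) := by
  rw [← IPol_univ]
  exact IPol_coeff_two G Finset.univ

lemma IPol_delv {V : Type} [Fintype V] (G : SimpleGraph V) (v : V) :
    (delv G v).indepPoly = IPol G (Finset.univ.erase v) := by
  rw [← IPol_univ, ← IPol_map (delv G v) G (Embedding.comap (Function.Embedding.subtype _) G)]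
  congr 1
  ext x
  simp only [Finset.mem_map, Finset.mem_univ, true_and, Finset.mem_erase, and_true]
  exact ⟨fun ⟨a, ha⟩ => ha ▸ a.2, fun h => ⟨⟨x, h⟩, rfl⟩⟩

lemma I3step {V : Type} [Fintype V] (G : SimpleGraph V) (v w : V) (hvw : w ≠ v)
    (hN : ∀ x, G.Adj v x ↔ x = w) :
    G.indepPoly.coeff 3 = (delv G v).indepPoly.coeff 3 + ((delv G v).indepPoly.coeff 2 -
      ((Fintype.card {x // x ≠ v} : ℚ) - 1) + dg (delv G v) ⟨w, hvw⟩) := by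
  have e1 : (Finset.univ : Finset V) = insert v (Finset.univ.erase v) := by
    rw [Finset.insert_erase (Finset.mem_univ v)]
  have e2 : (Finset.univ.erase v : Finset V) = insert w ((Finset.univ.erase v).erase w) := by
    rw [Finset.insert_erase (by simp [hvw])]
  have e3 : (Finset.univ.erase v).filter (fun x => ¬ G.Adj v x) = (Finset.univ.erase v).erase w := by
    ext x
    simp [hN, and_comm]
  have h2 : (delv G v).indepPoly.coeff 2 = (IPol G ((Finset.univ.erase v).erase w)).coeff 2 +
      ((((Finset.univ.erase v).erase w).filter (fun x => ¬ G.Adj w x)).card : ℚ) := by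
    rw [IPol_delv, e2, IPol_insert _ _ _ (by simp), coeff_add, ← e2,
      show (2 : ℕ) = 1 + 1 from rfl, coeff_X_mul, IPol_coeff_one]
  have h3 : G.indepPoly.coeff 3 = (delv G v).indepPoly.coeff 3 +
      (IPol G ((Finset.univ.erase v).erase w)).coeff 2 := by
    have e4 := IPol_insert G v (Finset.univ.erase v) (by simp)
    rw [← e1, e3] at e4
    rw [IPol_delv, ← IPol_univ, e4, coeff_add, show (3 : ℕ) = 2 + 1 from rfl, coeff_X_mul]
  have h4 := Finset.card_filter_add_card_filter_not (s := (Finset.univ.erase v).erase w)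
    (fun x => G.Adj w x)
  have h5 : (((Finset.univ.erase v).erase w).filter (fun x => G.Adj w x)).card =
      dg (delv G v) ⟨w, hvw⟩ := by
    have e5 : dg (delv G v) ⟨w, hvw⟩ =
        (Finset.univ.filter (fun y : {x // x ≠ v} => G.Adj w y)).card := by
      rw [Finset.card_filter]
      rfl
    rw [e5, ← Finset.card_map (Function.Embedding.subtype _)]
    congr 1
    ext x
    simp only [Finset.mem_filter, Finset.mem_erase, Finset.mem_univ, and_true, Finset.mem_map,
      true_and, comap_adj, Function.Embedding.subtype_apply]
    constructor
    · rintro ⟨⟨h1, h2⟩, h3⟩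
      exact ⟨⟨x, h2⟩, h3, rfl⟩
    · rintro ⟨⟨y, hy⟩, h3, rfl⟩
      exact ⟨⟨h3.ne', hy⟩, h3⟩
  have h6 : ((Finset.univ.erase v).erase w).card + 1 = Fintype.card {x // x ≠ v} := by
    rw [Finset.card_erase_add_one (by simp [hvw])]
    have := card_del v
    rw [Finset.card_erase_of_mem (by simp), Finset.card_univ]; omega
  rw [h3, h2, ← h6, ← h4, h5]
  push_cast
  ring

lemma I3 (n : ℕ) : ∀ (V : Type) [Fintype V] (G : SimpleGraph V), n ≤ 15 →
    Fintype.card V = n → G.Connected → ∑ x, dg G x = 2 * Fintype.card V →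
    (n : ℚ) * (n - 4) * (n - 5) + 6 * nl G ≤ 6 * (G.indepPoly.coeff 3 + 1) := by
  induction n with
  | zero =>
    intro V _ G _ hc hG hs
    have := uni_card G hG hs
    omega
  | succ n ih =>
    intro V _ G hn hc hG hs
    by_cases h : nl G = 0
    · obtain ⟨f, hf⟩ := class0 G hG hs h
      have h3 := uni_card G hG hs
      have := cycle_i3 (n + 1) (by simp; omega) (by omega)
      rw [hf.poly, toP_coeff, h, hc]
      simp only [code1]
      have h4 : ((n + 1 : ℕ) : ℤ) * (((n + 1 : ℕ) : ℤ) - 4) * (((n + 1 : ℕ) : ℤ) - 5) ≤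
          6 * (((cntc (cycC (n + 1)) 0).getD 3 0 : ℕ) + 1) := by
        exact_mod_cast this
      have h5 : (((n + 1 : ℕ) : ℤ) : ℚ) * ((((n + 1 : ℕ) : ℤ) : ℚ) - 4) *
          ((((n + 1 : ℕ) : ℤ) : ℚ) - 5) ≤
          6 * ((((cntc (cycC (n + 1)) 0).getD 3 0 : ℕ) : ℚ) + 1) := by
        exact_mod_cast h4
      push_cast at h5 ⊢
      linarith
    · obtain ⟨v, hv⟩ := nl_pos G h
      obtain ⟨w, hvw, hN, hcd, hcon, hs', hw2, hw, hnl⟩ := leaf_setup G hG hs v hv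
      have h1 := ih _ (delv G v) (by omega) (by omega) hcon hs'
      have h2 := I3step G v w hvw hN
      have h3 := coeff_two (delv G v)
      have h4 : (nl G : ℚ) ≤ nl (delv G v) + (dg (delv G v) ⟨w, hvw⟩ - 1) := by
        have : nl G + 1 ≤ nl (delv G v) + dg (delv G v) ⟨w, hvw⟩ := by
          split_ifs at hnl <;> omega
        have : (nl G : ℚ) + 1 ≤ nl (delv G v) + dg (delv G v) ⟨w, hvw⟩ := by exact_mod_cast this
        linarith
      rw [hs', show Fintype.card {x // x ≠ v} = n by omega] at h3
      rw [h2, show Fintype.card {x // x ≠ v} = n by omega]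
      push_cast at h3 ⊢
      nlinarith
end cf

/-! per-polynomial classification -/
lemma conn_setup {V : Type} [Fintype V] (G : SimpleGraph V) (l : List ℕ) (n L : ℕ)
    (h : G.indepPoly = toP l) (hG : G.Connected) (h1 : l.getD 1 0 = n)
    (h2 : 2 * l.getD 2 0 + 2 * n + n = n * n) (hn : n ≤ 15)
    (h3 : 6 * ((l.getD 3 0 : ℤ) + 1) < (n : ℤ) * (n - 4) * (n - 5) + 6 * (L + 1)) :
    Fintype.card V = n ∧ ∑ x, dg G x = 2 * Fintype.card V ∧ nl G ≤ L := by
  have hc : Fintype.card V = n := by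
    have := indepPoly_coeff_one G
    rw [h, toP_coeff, h1] at this
    exact_mod_cast this.symm
  have hs : ∑ x, dg G x = 2 * Fintype.card V := by
    have := coeff_two G
    rw [h, toP_coeff, hc] at this
    rw [hc]
    have h2' : (2 * (l.getD 2 0 : ℕ) + 2 * n + n : ℚ) = n * n := by exact_mod_cast h2
    have : ((∑ x, dg G x : ℕ) : ℚ) = ((2 * n : ℕ) : ℚ) := by
      push_cast at this ⊢
      linarith
    exact_mod_cast this
  refine ⟨hc, hs, ?_⟩
  have := I3 n V G hn hc hG hs
  rw [h, toP_coeff] at this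
  have h4 : (n : ℤ) * (n - 4) * (n - 5) + 6 * nl G ≤ 6 * ((l.getD 3 0 : ℕ) + 1) := by
    exact_mod_cast this
  have h5 : (nl G : ℤ) < L + 1 := by linarith
  omega

lemma chk1 {V : Type} [Fintype V] (G : SimpleGraph V) (l : List ℕ) (n L : ℕ)
    (h : G.indepPoly = toP l) (hG : G.Connected) (h1 : l.getD 1 0 = n)
    (h2 : 2 * l.getD 2 0 + 2 * n + n = n * n) (hn : n ≤ 15)
    (h3 : 6 * ((l.getD 3 0 : ℤ) + 1) < (n : ℤ) * (n - 4) * (n - 5) + 6 * (L + 1)) (hL : L ≤ 1)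
    (T : List (ℕ × ℕ))
    (hT : ∀ k ∈ List.range (n + 1), 3 ≤ k → cntN (code1 k (n - k)) 0 = evL l → (k, n - k) ∈ T) :
    ∃ k m f, (k, m) ∈ T ∧ GRep G (code1 k m) f := by
  obtain ⟨hc, hs, hl⟩ := conn_setup G l n L h hG h1 h2 hn h3
  obtain ⟨k, m, f, h4, h5, h6⟩ := class1 G hG hs (by omega)
  have hm : m = n - k := by omega
  refine ⟨k, m, f, ?_, h6⟩
  rw [hm]
  apply hT k (by simp; omega) h4
  rw [← hm]
  exact cntN_of_toP (h6.poly.symm.trans h)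

lemma chk2 {V : Type} [Fintype V] (G : SimpleGraph V) (l : List ℕ) (n L : ℕ)
    (h : G.indepPoly = toP l) (hG : G.Connected) (h1 : l.getD 1 0 = n)
    (h2 : 2 * l.getD 2 0 + 2 * n + n = n * n) (hn : n ≤ 15)
    (h3 : 6 * ((l.getD 3 0 : ℤ) + 1) < (n : ℤ) * (n - 4) * (n - 5) + 6 * (L + 1)) (hL : L ≤ 2)
    (T : List (ℕ × ℕ)) (T' : List (ℕ × ℕ × ℕ × ℕ))
    (hT : ∀ k ∈ List.range (n + 1), 3 ≤ k → cntN (code1 k (n - k)) 0 = evL l → (k, n - k) ∈ T)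
    (hT' : ∀ k ∈ List.range (n + 1), 3 ≤ k → ∀ m ∈ List.range (n + 1), 1 ≤ m → k + m < n →
      ∀ q ∈ List.range (k + m), cntN (code2 k m q (n - (k + m))) 0 = evL l →
      (k, m, q, n - (k + m)) ∈ T') :
    (∃ k m f, (k, m) ∈ T ∧ GRep G (code1 k m) f) ∨
    (∃ k m q l f, (k, m, q, l) ∈ T' ∧ GRep G (code2 k m q l) f) := by
  obtain ⟨hc, hs, hl⟩ := conn_setup G l n L h hG h1 h2 hn h3
  rcases class2 G hG hs (by omega) with ⟨k, m, f, h4, h5, h6⟩ |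
    ⟨k, m, q, e, f, h4, h5, h6, h7, h8, h9⟩
  · left
    have hm : m = n - k := by omega
    refine ⟨k, m, f, ?_, h6⟩
    rw [hm]
    apply hT k (by simp; omega) h4
    rw [← hm]
    exact cntN_of_toP (h6.poly.symm.trans h)
  · right
    have hm : e = n - (k + m) := by omega
    refine ⟨k, m, q, e, f, ?_, h9⟩
    rw [hm]
    apply hT' k (by simp; omega) h4 m (by simp; omega) h5 (by omega) q (by simpa using h7)
    rw [← hm]
    exact cntN_of_toP (h9.poly.symm.trans h)

lemma cl3 {V : Type} [Fintype V] (G : SimpleGraph V) (hG : G.Connected)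
    (h : G.indepPoly = toP [1, 3]) : Nonempty (G ≃g cycleGraph 3) := by
  obtain ⟨k, m, f, hT, hf⟩ := chk1 G [1, 3] 3 0 h hG rfl rfl (by norm_num) (by norm_num)
    (by norm_num) [(3, 0)] (by decide +kernel)
  simp at hT
  obtain ⟨rfl, rfl⟩ := hT
  exact ⟨(hf.iso rep_C3).choose⟩

lemma cl5 {V : Type} [Fintype V] (G : SimpleGraph V) (hG : G.Connected)
    (h : G.indepPoly = toP [1, 5, 5]) : Nonempty (G ≃g cycleGraph 5) ∨ Nonempty (G ≃g Dgraph 5) := by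
  obtain ⟨k, m, f, hT, hf⟩ := chk1 G [1, 5, 5] 5 1 h hG rfl rfl (by norm_num) (by norm_num)
    (by norm_num) [(5, 0), (3, 2)] (by decide +kernel)
  simp at hT
  obtain ⟨rfl, rfl⟩ | ⟨rfl, rfl⟩ := hT
  · exact Or.inl ⟨(hf.iso rep_C5).choose⟩
  · exact Or.inr ⟨(hf.iso rep_D5).choose⟩

lemma cl15 {V : Type} [Fintype V] (G : SimpleGraph V) (hG : G.Connected)
    (h : G.indepPoly = toP [1, 7, 14, 8, 1]) : Nonempty (G ≃g Agraph 1 3) ∨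
      Nonempty (G ≃g Egraph 1 3) ∨ Nonempty (G ≃g Egraph 3 1) := by
  rcases chk2 G [1, 7, 14, 8, 1] 7 2 h hG rfl rfl (by norm_num) (by norm_num)
    (by norm_num) [(4, 3), (6, 1)]
    [(3, 1, 1, 3), (3, 1, 2, 3), (3, 3, 1, 1), (3, 3, 2, 1), (4, 1, 4, 2), (4, 2, 5, 1)]
    (by decide +kernel) (by decide +kernel) with ⟨k, m, f, hT, hf⟩ | ⟨k, m, q, l, f, hT, hf⟩
  · simp at hT
    obtain ⟨rfl, rfl⟩ | ⟨rfl, rfl⟩ := hT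
    · exact Or.inr (Or.inl ⟨(hf.iso rep_E13).choose⟩)
    · exact Or.inr (Or.inr ⟨(hf.iso rep_E31).choose⟩)
  · simp at hT
    obtain ⟨rfl, rfl, rfl, rfl⟩ | ⟨rfl, rfl, rfl, rfl⟩ | ⟨rfl, rfl, rfl, rfl⟩ |
      ⟨rfl, rfl, rfl, rfl⟩ | ⟨rfl, rfl, rfl, rfl⟩ | ⟨rfl, rfl, rfl, rfl⟩ := hT
    · exact Or.inl ⟨(hf.iso rep_A1).choose⟩
    · exact Or.inl ⟨(hf.iso rep_A2).choose⟩
    · exact Or.inl ⟨(hf.iso rep_A3).choose⟩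
    · exact Or.inl ⟨(hf.iso rep_A4).choose⟩
    · exact Or.inr (Or.inl ⟨(hf.iso rep_E13').choose⟩)
    · exact Or.inr (Or.inl ⟨(hf.iso rep_E13'').choose⟩)

lemma cl3_5 {V : Type} [Fintype V] (G : SimpleGraph V) (hG : G.Connected)
    (h : G.indepPoly = toP [1, 8, 20, 15]) : False := by
  obtain ⟨hc, hs, hl⟩ := conn_setup G [1, 8, 20, 15] 8 0 h hG rfl rfl (by norm_num) (by norm_num)
  obtain ⟨f, hf⟩ := class0 G hG hs (by omega)
  rw [hc] at hf
  have h1 := cntN_of_toP (hf.poly.symm.trans h)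
  have h2 : cntN (code1 8 0) 0 ≠ evL [1, 8, 20, 15] := by decide +kernel
  exact h2 h1

lemma cl3_15 {V : Type} [Fintype V] (G : SimpleGraph V) (hG : G.Connected)
    (h : G.indepPoly = toP [1, 10, 35, 50, 25, 3]) : False := by
  obtain ⟨k, m, f, hT, hf⟩ := chk1 G _ 10 1 h hG rfl rfl (by norm_num) (by norm_num)
    (by norm_num) [] (by decide +kernel)
  simp at hT

lemma cl5_15 {V : Type} [Fintype V] (G : SimpleGraph V) (hG : G.Connected)
    (h : G.indepPoly = toP [1, 12, 54, 113, 111, 45, 5]) : False := by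
  rcases chk2 G _ 12 2 h hG rfl rfl (by norm_num) (by norm_num)
    (by norm_num) [] [] (by decide +kernel) (by decide +kernel) with
    ⟨k, m, f, hT, hf⟩ | ⟨k, m, q, l, f, hT, hf⟩
  · simp at hT
  · simp at hT

lemma clall {V : Type} [Fintype V] (G : SimpleGraph V) (hG : G.Connected)
    (h : G.indepPoly = toP [1, 15, 90, 275, 450, 378, 140, 15]) :
    Nonempty (G ≃g cycleGraph 15) ∨ Nonempty (G ≃g Dgraph 15) := by
  obtain ⟨k, m, f, hT, hf⟩ := chk1 G _ 15 1 h hG rfl rfl (by norm_num) (by norm_num)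
    (by norm_num) [(15, 0), (3, 12)] (by decide +kernel)
  simp at hT
  obtain ⟨rfl, rfl⟩ | ⟨rfl, rfl⟩ := hT
  · exact Or.inl ⟨(hf.iso rep_C15).choose⟩
  · exact Or.inr ⟨(hf.iso rep_D15).choose⟩

/-! irreducibility -/
lemma prime_f3 : Prime (toP [1, 3]) := by
  apply prime_of_degree_eq_one
  have : toP [1, 3] = C 3 * X + C 1 := by simp [toP]; ring
  rw [this]
  exact degree_linear (by norm_num)

lemma prime_f5 : Prime (toP [1, 5, 5]) := by
  apply Irreducible.prime
  have h : toP [1, 5, 5] = C 5 * X ^ 2 + C 5 * X + C 1 := by simp [toP]; ring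
  rw [h]
  apply irreducible_of_degree_le_three_of_not_isRoot
  · rw [natDegree_quadratic (by norm_num)]; simp
  · intro x hx
    simp [IsRoot] at hx
    have h1 : (10 * x + 5) * (10 * x + 5) = 5 := by linear_combination 20 * hx
    have h2 : IsSquare (5 : ℚ) := ⟨_, h1.symm⟩
    have h3 : IsSquare ((5 : ℕ) : ℚ) := by exact_mod_cast h2
    rw [Rat.isSquare_natCast_iff] at h3
    obtain ⟨r, hr⟩ := h3
    have : r < 3 := by nlinarith
    interval_cases r <;> omega

lemma prime_f15 : Prime (toP [1, 7, 14, 8, 1]) := by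
  apply Irreducible.prime
  set P : ℤ[X] := X ^ 4 + (C 8 * X ^ 3 + C 14 * X ^ 2 + C 7 * X + C 1) with hP
  have hdeg : (C 8 * X ^ 3 + C 14 * X ^ 2 + C 7 * X + C 1 : ℤ[X]).degree < 4 := by
    rw [degree_cubic (by norm_num)]; norm_num
  have hm : P.Monic := monic_X_pow_add hdeg
  have hnd : P.natDegree = 4 := by
    rw [hP]; compute_degree!
  have hmap : toP [1, 7, 14, 8, 1] = P.map (algebraMap ℤ ℚ) := by
    simp [toP, hP, map_ofNat]; ring
  rw [hmap, ← hm.irreducible_iff_irreducible_map_fraction_map, hm.irreducible_iff_natDegree']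
  constructor
  · intro h
    rw [h] at hnd
    simp at hnd
  · intro f g hf hg hfg hd
    have hsum : f.natDegree + g.natDegree = 4 := by rw [← hf.natDegree_mul hg, hfg, hnd]
    rw [hnd, Finset.mem_Ioc] at hd
    have e0 : f.eval 0 * g.eval 0 = 1 := by rw [← eval_mul, hfg]; simp [hP]
    have e1 : f.eval 1 * g.eval 1 = 31 := by rw [← eval_mul, hfg]; simp [hP]
    have e2 : f.eval (-1) * g.eval (-1) = 1 := by rw [← eval_mul, hfg]; simp [hP]
    have hga := hg.as_sum
    have hfa := hf.as_sum
    obtain h | h : g.natDegree = 1 ∨ g.natDegree = 2 := by omega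
    · rw [h] at hga
      simp [Finset.sum_range_succ] at hga
      set b := g.coeff 0
      rw [hga] at e0 e2
      simp at e0 e2
      have h1 := Int.isUnit_iff.1 (IsUnit.of_mul_eq_one_right _ e0)
      have h2 := Int.isUnit_iff.1 (IsUnit.of_mul_eq_one_right _ e2)
      omega
    · rw [h] at hga
      rw [show f.natDegree = 2 by omega] at hfa
      simp [Finset.sum_range_succ] at hga hfa
      set b := g.coeff 0
      set a := g.coeff 1
      set d := f.coeff 0
      set c := f.coeff 1
      rw [hga, hfa] at e0 e1 e2
      simp at e0 e1 e2
      have h1 := Int.isUnit_iff.1 (IsUnit.of_mul_eq_one_right _ e0)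
      rcases h1 with h1 | h1
      · have hd' : d = 1 := by rw [h1] at e0; omega
        rw [h1, hd'] at e1 e2
        have : 4 * (a + c) = 30 := by linear_combination e1 - e2
        omega
      · have hd' : d = -1 := by rw [h1] at e0; omega
        rw [h1, hd'] at e1 e2
        have : (0 : ℤ) = 30 := by linear_combination e1 - e2
        omega

lemma psplit {p A B D : ℚ[X]} (hp : Prime p) (h : A * B = p * D) :
    (∃ A', A = p * A' ∧ A' * B = D) ∨ (∃ B', B = p * B' ∧ A * B' = D) := by
  rcases hp.dvd_or_dvd (Dvd.intro _ h.symm) with ⟨A', rfl⟩ | ⟨B', rfl⟩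
  · left
    refine ⟨A', rfl, mul_left_cancel₀ hp.ne_zero ?_⟩
    rw [← h]; ring
  · right
    refine ⟨B', rfl, mul_left_cancel₀ hp.ne_zero ?_⟩
    rw [← h]; ring

lemma punit {A B : ℚ[X]} (h : A * B = 1) (hA : A.coeff 0 = 1) : A = 1 := by
  have hu : IsUnit A := IsUnit.of_mul_eq_one _ h
  obtain ⟨r, -, hr⟩ := Polynomial.isUnit_iff.1 hu
  rw [← hr] at hA ⊢
  simp at hA
  simp [hA]

/-! decomposition -/
lemma split_iso {V : Type} (H : SimpleGraph V) (s : Set V)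
    (hs : ∀ x ∈ s, ∀ y ∉ s, ¬ H.Adj x y) :
    Nonempty (H ≃g (H.induce s) ⊕g (H.induce sᶜ)) := by
  classical
  refine ⟨RelIso.symm ⟨Equiv.Set.sumCompl s, ?_⟩⟩
  rintro (a | a) (b | b)
  · simp
  · simp [hs a a.2 b b.2]
  · have := hs b b.2 a a.2
    rw [H.adj_comm] at this
    simp [this]
  · simp

lemma decomp (p : ℚ[X]) (hp : Prime p) (n : ℕ) : ∀ (V : Type) [Fintype V] (H : SimpleGraph V),
    Fintype.card V = n → p ∣ H.indepPoly →
    ∃ (W U : Type) (_ : Fintype W) (_ : Fintype U) (K : SimpleGraph W) (R : SimpleGraph U),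
      K.Connected ∧ p ∣ K.indepPoly ∧ Nonempty (H ≃g K ⊕g R) := by
  classical
  induction n using Nat.strong_induction_on with
  | _ n ih =>
    intro V _ H hc hd
    rcases isEmpty_or_nonempty V with hV | ⟨⟨v⟩⟩
    · rw [indepPoly_isEmpty] at hd
      exact absurd (isUnit_of_dvd_one hd) hp.not_isUnit
    · set c := H.connectedComponentMk v
      have hv : v ∈ c.supp := rfl
      obtain ⟨e⟩ := split_iso H c.supp (by
        intro x hx y hy hxy
        exact hy (c.mem_supp_of_adj_mem_supp hx hxy))
      have hK : (H.induce c.supp).Connected := c.connected_toSimpleGraph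
      rw [indepPoly_iso e, indepPoly_sum] at hd
      rcases hp.dvd_or_dvd hd with hd | hd
      · exact ⟨_, _, inferInstance, inferInstance, _, _, hK, hd, ⟨e⟩⟩
      · have hlt : Fintype.card (c.suppᶜ : Set V) < n := by
          rw [← hc]
          exact Fintype.card_subtype_lt (x := v) (by simp [hv])
        obtain ⟨W, U, _, _, K, R, h1, h2, ⟨e'⟩⟩ := ih _ hlt _ (H.induce c.suppᶜ) rfl hd
        refine ⟨W, c.supp ⊕ U, inferInstance, inferInstance, K, H.induce c.supp ⊕g R, h1, h2, ⟨?_⟩⟩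
        exact (e.trans (Iso.sumCongr Iso.refl e')).trans
          ((Iso.sumAssoc.symm.trans (Iso.sumCongr Iso.sumComm Iso.refl)).trans Iso.sumAssoc)

lemma empty_of_one {V : Type} [Fintype V] (H : SimpleGraph V) (h : H.indepPoly = 1) : IsEmpty V := by
  have := indepPoly_coeff_one H
  rw [h, Polynomial.coeff_one] at this
  simp at this
  exact Fintype.card_eq_zero_iff.1 (by exact_mod_cast this.symm)

lemma sum_empty_iso {V W : Type} (G : SimpleGraph V) (R : SimpleGraph W) [IsEmpty W] :
    Nonempty (G ⊕g R ≃g G) := by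
  refine ⟨⟨Equiv.sumEmpty V W, ?_⟩⟩
  rintro (a | a) (b | b)
  · simp
  · exact isEmptyElim b
  · exact isEmptyElim a
  · exact isEmptyElim a

lemma mul35 : toP [1, 3] * toP [1, 5, 5] = toP [1, 8, 20, 15] := by
  simp [toP, map_ofNat]; ring
lemma mul315 : toP [1, 3] * toP [1, 7, 14, 8, 1] = toP [1, 10, 35, 50, 25, 3] := by
  simp [toP, map_ofNat]; ring
lemma mul515 : toP [1, 5, 5] * toP [1, 7, 14, 8, 1] = toP [1, 12, 54, 113, 111, 45, 5] := by
  simp [toP, map_ofNat]; ring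
lemma mulall : toP [1, 3] * (toP [1, 5, 5] * toP [1, 7, 14, 8, 1]) =
    toP [1, 15, 90, 275, 450, 378, 140, 15] := by
  simp [toP, map_ofNat]; ring
lemma toP_zero (a : ℕ) (l : List ℕ) : (toP (a :: l)).coeff 0 = a := by simp [toP]

lemma conn_ne {V : Type} [Fintype V] (G : SimpleGraph V) (hG : G.Connected)
    (h : G.indepPoly = 1) : False := by
  have := empty_of_one G h
  have := hG.nonempty
  exact (not_isEmpty_iff.2 this) inferInstance

-- third stage
lemma st15 {V : Type} [Fintype V] (H : SimpleGraph V)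
    (h : H.indepPoly = toP [1, 7, 14, 8, 1]) : Nonempty (H ≃g Agraph 1 3) ∨
      Nonempty (H ≃g Egraph 1 3) ∨ Nonempty (H ≃g Egraph 3 1) := by
  obtain ⟨W, U, _, _, K, R, hK, ⟨A, hA⟩, ⟨e⟩⟩ := decomp _ prime_f15 _ V H rfl (by rw [h])
  rw [indepPoly_iso e, indepPoly_sum, hA] at h
  have h1 : A * R.indepPoly = 1 :=
    mul_left_cancel₀ prime_f15.ne_zero (by rw [← mul_assoc, h, mul_one])
  have h2 : R.indepPoly = 1 := punit (by rw [mul_comm]; exact h1) (indepPoly_coeff_zero R)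
  rw [h2, mul_one] at h1
  rw [h1, mul_one] at hA
  have := empty_of_one R h2
  obtain ⟨e'⟩ := sum_empty_iso K R
  have e2 := e.trans e'
  rcases cl15 K hK hA with ⟨⟨i⟩⟩ | ⟨⟨i⟩⟩ | ⟨⟨i⟩⟩
  · exact Or.inl ⟨e2.trans i⟩
  · exact Or.inr (Or.inl ⟨e2.trans i⟩)
  · exact Or.inr (Or.inr ⟨e2.trans i⟩)

lemma st5 {V : Type} [Fintype V] (H : SimpleGraph V)
    (h : H.indepPoly = toP [1, 5, 5] * toP [1, 7, 14, 8, 1]) :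
    ∃ (W U : Type) (_ : Fintype U) (K : SimpleGraph W) (R : SimpleGraph U),
      (Nonempty (K ≃g cycleGraph 5) ∨ Nonempty (K ≃g Dgraph 5)) ∧
      R.indepPoly = toP [1, 7, 14, 8, 1] ∧ Nonempty (H ≃g K ⊕g R) := by
  obtain ⟨W, U, _, _, K, R, hK, ⟨A, hA⟩, ⟨e⟩⟩ := decomp _ prime_f5 _ V H rfl
    (by rw [h]; exact Dvd.intro _ rfl)
  rw [indepPoly_iso e, indepPoly_sum, hA] at h
  have h0 := indepPoly_coeff_zero K
  have h1 : A * R.indepPoly = toP [1, 7, 14, 8, 1] * 1 :=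
    mul_left_cancel₀ prime_f5.ne_zero (by rw [← mul_assoc, h, mul_one])
  rcases psplit prime_f15 h1 with ⟨A', rfl, h2⟩ | ⟨B, h3, h2⟩
  · have hA' : A' = 1 := punit h2 (by simpa [hA, mul_coeff_zero, toP_zero] using h0)
    rw [hA', mul_one, mul515] at hA
    exact (cl5_15 K hK hA).elim
  · have hA' : A = 1 := punit h2 (by simpa [hA, mul_coeff_zero, toP_zero] using h0)
    rw [hA', one_mul] at h2
    rw [hA', mul_one] at hA
    rw [h2, mul_one] at h3
    exact ⟨W, U, _, K, R, cl5 K hK hA, h3, ⟨e⟩⟩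

lemma st3 {V : Type} [Fintype V] (H : SimpleGraph V)
    (h : H.indepPoly = toP [1, 3] * (toP [1, 5, 5] * toP [1, 7, 14, 8, 1])) :
    (Nonempty (H ≃g cycleGraph 15) ∨ Nonempty (H ≃g Dgraph 15)) ∨
    ∃ (W U : Type) (_ : Fintype U) (K : SimpleGraph W) (R : SimpleGraph U),
      Nonempty (K ≃g cycleGraph 3) ∧
      R.indepPoly = toP [1, 5, 5] * toP [1, 7, 14, 8, 1] ∧ Nonempty (H ≃g K ⊕g R) := by
  obtain ⟨W, U, _, _, K, R, hK, ⟨A, hA⟩, ⟨e⟩⟩ := decomp _ prime_f3 _ V H rfl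
    (by rw [h]; exact Dvd.intro _ rfl)
  rw [indepPoly_iso e, indepPoly_sum, hA] at h
  have h0 := indepPoly_coeff_zero K
  have h1 : A * R.indepPoly = toP [1, 5, 5] * toP [1, 7, 14, 8, 1] :=
    mul_left_cancel₀ prime_f3.ne_zero (by rw [← mul_assoc, h])
  rcases psplit prime_f5 h1 with ⟨A', rfl, h2⟩ | ⟨B, h3, h2⟩
  · rw [← mul_one (toP [1, 7, 14, 8, 1])] at h2
    rcases psplit prime_f15 h2 with ⟨A'', rfl, h4⟩ | ⟨B, h3, h4⟩
    · have hA' : A'' = 1 := punit h4 (by simpa [hA, mul_coeff_zero, toP_zero] using h0)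
      rw [hA', mul_one, mulall] at hA
      rw [hA', one_mul] at h4
      have := empty_of_one R h4
      obtain ⟨e'⟩ := sum_empty_iso K R
      have e2 := e.trans e'
      left
      rcases clall K hK hA with ⟨⟨i⟩⟩ | ⟨⟨i⟩⟩
      · exact Or.inl ⟨e2.trans i⟩
      · exact Or.inr ⟨e2.trans i⟩
    · have hA' : A' = 1 := punit h4 (by simpa [hA, mul_coeff_zero, toP_zero] using h0)
      rw [hA', mul_one, mul35] at hA
      exact (cl3_5 K hK hA).elim
  · rw [← mul_one (toP [1, 7, 14, 8, 1])] at h2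
    rcases psplit prime_f15 h2 with ⟨A'', rfl, h4⟩ | ⟨B', rfl, h4⟩
    · have hA' : A'' = 1 := punit h4 (by simpa [hA, mul_coeff_zero, toP_zero] using h0)
      rw [hA', mul_one, mul315] at hA
      exact (cl3_15 K hK hA).elim
    · have hA' : A = 1 := punit h4 (by simpa [hA, mul_coeff_zero, toP_zero] using h0)
      rw [hA', one_mul] at h4
      rw [hA', mul_one] at hA
      rw [h4, mul_one] at h3
      exact Or.inr ⟨W, U, _, K, R, cl3 K hK hA, h3, ⟨e⟩⟩

lemma pl {V : Type} [Fintype V] {G : SimpleGraph V} {g : List ℕ} {f : V → ℕ} (l : List ℕ)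
    (h : GRep G g f) (e : cntc g 0 = l) : G.indepPoly = toP l := by rw [h.poly, e]

/-- The independence equivalence class of `C_15` consists of exactly eight graphs:
`C_15`, `D_15`, and `C_3 ∪ C_5 ∪ X`, `C_3 ∪ D_5 ∪ X` where `X` is one of
`A_{1,3}`, `E_{1,3}`, `E_{3,1}`. -/
theorem indep_equiv_class_C15 {V : Type} [Fintype V] (H : SimpleGraph V) :
    H.indepPoly = (cycleGraph 15).indepPoly ↔
      (Nonempty (H ≃g cycleGraph 15) ∨
       Nonempty (H ≃g Dgraph 15) ∨
       Nonempty (H ≃g cycleGraph 3 ⊕g cycleGraph 5 ⊕g Agraph 1 3) ∨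
       Nonempty (H ≃g cycleGraph 3 ⊕g Dgraph 5 ⊕g Agraph 1 3) ∨
       Nonempty (H ≃g cycleGraph 3 ⊕g cycleGraph 5 ⊕g Egraph 1 3) ∨
       Nonempty (H ≃g cycleGraph 3 ⊕g Dgraph 5 ⊕g Egraph 1 3) ∨
       Nonempty (H ≃g cycleGraph 3 ⊕g cycleGraph 5 ⊕g Egraph 3 1) ∨
       Nonempty (H ≃g cycleGraph 3 ⊕g Dgraph 5 ⊕g Egraph 3 1)) := by
  have hC15 : (cycleGraph 15).indepPoly = toP [1, 3] * (toP [1, 5, 5] * toP [1, 7, 14, 8, 1]) := by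
    rw [mulall]; exact pl _ rep_C15 (by decide +kernel)
  have hD15 : (Dgraph 15).indepPoly = toP [1, 3] * (toP [1, 5, 5] * toP [1, 7, 14, 8, 1]) := by
    rw [mulall]; exact pl _ rep_D15 (by decide +kernel)
  have hC3 : (cycleGraph 3).indepPoly = toP [1, 3] := pl _ rep_C3 (by decide +kernel)
  have hC5 : (cycleGraph 5).indepPoly = toP [1, 5, 5] := pl _ rep_C5 (by decide +kernel)
  have hD5 : (Dgraph 5).indepPoly = toP [1, 5, 5] := pl _ rep_D5 (by decide +kernel)
  have hA : (Agraph 1 3).indepPoly = toP [1, 7, 14, 8, 1] := pl _ rep_A1 (by decide +kernel)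
  have hE : (Egraph 1 3).indepPoly = toP [1, 7, 14, 8, 1] := pl _ rep_E13 (by decide +kernel)
  have hE' : (Egraph 3 1).indepPoly = toP [1, 7, 14, 8, 1] := pl _ rep_E31 (by decide +kernel)
  constructor
  · intro h
    rw [hC15] at h
    rcases st3 H h with (h | h) | ⟨W, U, _, K, R, ⟨i3⟩, hR, ⟨e⟩⟩
    · exact Or.inl h
    · exact Or.inr (Or.inl h)
    · obtain ⟨W', U', _, K', R', i5, hR', ⟨e'⟩⟩ := st5 R hR
      have i15 := st15 R' hR'
      have e2 : H ≃g (K ⊕g K') ⊕g R' :=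
        (e.trans (Iso.sumCongr Iso.refl e')).trans Iso.sumAssoc.symm
      right; right
      rcases i5 with ⟨⟨i5⟩⟩ | ⟨⟨i5⟩⟩ <;> rcases i15 with ⟨⟨i⟩⟩ | ⟨⟨i⟩⟩ | ⟨⟨i⟩⟩ <;>
        have e3 := e2.trans (Iso.sumCongr (Iso.sumCongr i3 i5) i)
      · exact Or.inl ⟨e3⟩
      · exact Or.inr (Or.inr (Or.inl ⟨e3⟩))
      · exact Or.inr (Or.inr (Or.inr (Or.inr (Or.inl ⟨e3⟩))))
      · exact Or.inr (Or.inl ⟨e3⟩)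
      · exact Or.inr (Or.inr (Or.inr (Or.inl ⟨e3⟩)))
      · exact Or.inr (Or.inr (Or.inr (Or.inr (Or.inr ⟨e3⟩))))
  · rw [hC15]
    rintro (⟨⟨e⟩⟩ | ⟨⟨e⟩⟩ | ⟨⟨e⟩⟩ | ⟨⟨e⟩⟩ | ⟨⟨e⟩⟩ | ⟨⟨e⟩⟩ | ⟨⟨e⟩⟩ | ⟨⟨e⟩⟩) <;> rw [indepPoly_iso e]
    · exact hC15
    · exact hD15
    · rw [indepPoly_sum, indepPoly_sum, hC3, hC5, hA, mul_assoc]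
    · rw [indepPoly_sum, indepPoly_sum, hC3, hD5, hA, mul_assoc]
    · rw [indepPoly_sum, indepPoly_sum, hC3, hC5, hE, mul_assoc]
    · rw [indepPoly_sum, indepPoly_sum, hC3, hD5, hE, mul_assoc]
    · rw [indepPoly_sum, indepPoly_sum, hC3, hC5, hE', mul_assoc]
    · rw [indepPoly_sum, indepPoly_sum, hC3, hD5, hE', mul_assoc]
end
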